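/- arXiv:1301.1524 — 3 statements merged into one kernel-verified Lean document; each statement's English description precedes it below -/
import Mathlib

section
/- Let n be a positive integer, a ∈ (0,2), b > 0 with a + b ≤ n, and let α_{a,n} := 2^{a−1} π^{−n/2} Γ((n+a)/2) / |Γ(−a/2)|. Then for every nonzero smooth compactly supported ψ : ℝⁿ → ℂ, the kernel form K(ψ) := α_{a,n} · Re ∫_{ℝⁿ}∫_{ℝⁿ} (conj(ψ(x)) − conj(ψ(y)))(|x|^b ψ(x) − |y|^b ψ(y)) / |x−y|^{n+a} dx dy is strictly positive. -/
open MeasureTheory Real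

/-- The constant `α_{a,n} = 2^{a-1} π^{-n/2} Γ((n+a)/2) / |Γ(-a/2)|` in the
singular-integral representation of `|p|^a`. -/
noncomputable def alphaConst (n : ℕ) (a : ℝ) : ℝ :=
  2 ^ (a - 1) * Real.pi ^ (-(n : ℝ) / 2) * Real.Gamma (((n : ℝ) + a) / 2) /
    |Real.Gamma (-a / 2)|

/-- The kernel form
`K(ψ) = α_{a,n} Re ∫∫ (conj ψ(x) - conj ψ(y))(|x|^b ψ(x) - |y|^b ψ(y)) / |x-y|^{n+a}`. -/
noncomputable def kernelForm (n : ℕ) (a b : ℝ)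
    (ψ : EuclideanSpace ℝ (Fin n) → ℂ) : ℝ :=
  alphaConst n a *
    (∫ x : EuclideanSpace ℝ (Fin n), ∫ y : EuclideanSpace ℝ (Fin n),
        (((starRingEnd ℂ) (ψ x) - (starRingEnd ℂ) (ψ y)) *
          ((‖x‖ ^ b : ℝ) • ψ x - (‖y‖ ^ b : ℝ) • ψ y)) /
          (Complex.ofReal (‖x - y‖ ^ ((n : ℝ) + a)))).re

lemma abs_rpow_sub_rpow_le {X Y b : ℝ} (hX : 0 < X) (hY : 0 ≤ Y) (hYX : Y ≤ X) (hb : 0 < b) :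
    |X ^ b - Y ^ b| ≤ (1 + b) * X ^ (b - 1) * (X - Y) := by
  have hu0 : 0 ≤ Y / X := by positivity
  have hu1 : Y / X ≤ 1 := (div_le_one hX).2 hYX
  have key : 1 - (Y / X) ^ b ≤ (1 + b) * (1 - Y / X) := by
    rcases le_total 1 b with h | h
    · have := one_add_mul_self_le_rpow_one_add (s := Y / X - 1) (by linarith) h
      rw [add_sub_cancel] at this
      nlinarith
    · have := Real.rpow_le_rpow_of_exponent_ge' hu0 hu1 hb.le h
      rw [Real.rpow_one] at this
      nlinarith
  have hYb : Y ^ b = X ^ b * (Y / X) ^ b := by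
    rw [← Real.mul_rpow hX.le hu0, mul_div_cancel₀ _ hX.ne']
  have hXb : X ^ b = X ^ (b - 1) * X := by
    rw [← Real.rpow_add_one hX.ne', sub_add_cancel]
  rw [abs_of_nonneg (sub_nonneg.2 (Real.rpow_le_rpow hY hYX hb.le))]
  calc X ^ b - Y ^ b = X ^ b * (1 - (Y / X) ^ b) := by rw [hYb]; ring
    _ ≤ X ^ b * ((1 + b) * (1 - Y / X)) := by gcongr
    _ = (1 + b) * X ^ (b - 1) * (X - Y) := by rw [hXb]; field_simp

lemma abs_rpow_sub_rpow_le_max {X Y b : ℝ} (hX : 0 < X) (hY : 0 ≤ Y) (hb : 0 < b) :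
    |X ^ b - Y ^ b| ≤ (1 + b) * (max X Y) ^ (b - 1) * |X - Y| := by
  rcases le_total Y X with h | h
  · rw [max_eq_left h, abs_of_nonneg (sub_nonneg.2 h)]
    exact abs_rpow_sub_rpow_le hX hY h hb
  · rw [max_eq_right h, abs_sub_comm, abs_sub_comm X, abs_of_nonneg (sub_nonneg.2 h)]
    exact abs_rpow_sub_rpow_le (hX.trans_le h) hX.le h hb

section RadialPowers

variable {E : Type*} [NormedAddCommGroup E] [NormedSpace ℝ E] [FiniteDimensional ℝ E]
  [MeasurableSpace E] [BorelSpace E] [Nontrivial E] (μ : Measure E) [μ.IsAddHaarMeasure]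

lemma integrableOn_ball_norm_rpow {s : ℝ} (hs : -(Module.finrank ℝ E : ℝ) < s) (R : ℝ) :
    IntegrableOn (fun x : E => ‖x‖ ^ s) (Metric.ball 0 R) μ := by
  refine integrableOn_ball_of_norm_le_rpow (C := 1) (α := -s) Module.finrank_pos (by linarith)
    (Filter.Eventually.of_forall fun x => ?_) ?_
  · rw [Real.norm_of_nonneg (by positivity), one_mul, neg_neg]
  · exact (by fun_prop : Measurable fun x : E => ‖x‖ ^ s).aestronglyMeasurable

lemma integrableOn_compl_closedBall_norm_rpow {s R : ℝ} (hs : s < -(Module.finrank ℝ E : ℝ))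
    (hR : 0 < R) : IntegrableOn (fun x : E => ‖x‖ ^ s) (Metric.closedBall 0 R)ᶜ μ := by
  rw [← integrable_indicator_iff Metric.isClosed_closedBall.measurableSet.compl]
  have h := (integrable_fun_norm_addHaar μ (E := E)
    (f := (Set.Ioi R).indicator fun r : ℝ => r ^ s)).2 ?_
  · refine h.congr (Filter.Eventually.of_forall fun x => ?_)
    simp [Set.indicator]
  have h1 := integrableOn_Ioi_rpow_of_lt
    (a := s + (Module.finrank ℝ E : ℝ) - 1) (by linarith) hR
  rw [← integrable_indicator_iff measurableSet_Ioi] at h1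
  refine (h1.integrableOn (s := Set.Ioi 0)).congr_fun (fun r hr => ?_) measurableSet_Ioi
  have hr : 0 < r := hr
  simp only [Set.indicator, Set.mem_Ioi, smul_eq_mul]
  split_ifs
  · rw [← Real.rpow_natCast, ← Real.rpow_add hr, Nat.cast_sub Module.finrank_pos]
    congr 1
    push_cast
    ring
  · simp

variable {μ} in
omit [Nontrivial E] in
lemma Integrable.mul_prod_sub {u v : E → ℝ} (hu : Integrable u μ) (hv : Integrable v μ) :
    Integrable (fun z : E × E => u z.1 * v (z.1 - z.2)) (μ.prod μ) := by
  have hv' : Integrable (fun x => v (-x)) μ := hv.comp_neg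
  have h3 := (measurePreserving_prod_sub μ μ (G := E)).integrable_comp_of_integrable
    (hu.mul_prod hv')
  refine h3.congr (Filter.Eventually.of_forall fun z => ?_)
  simp

end RadialPowers

section Inversion

open EuclideanGeometry

variable {E : Type*} [NormedAddCommGroup E] [InnerProductSpace ℝ E] [FiniteDimensional ℝ E]
  [MeasurableSpace E] [BorelSpace E]

omit [MeasurableSpace E] [BorelSpace E] in
lemma abs_det_smul_reflection (c : ℝ) (K : Submodule ℝ E) :
    |(c • (K.reflection : E →L[ℝ] E)).det| = |c| ^ Module.finrank ℝ E := by
  have h : (K.reflection : E →L[ℝ] E).toLinearMap = K.reflection.toLinearMap := rfl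
  rw [ContinuousLinearMap.det, ContinuousLinearMap.toLinearMap_smul, LinearMap.det_smul, abs_mul,
    abs_pow, h, Submodule.det_reflection]
  simp

omit [FiniteDimensional ℝ E] [MeasurableSpace E] [BorelSpace E] in
lemma image_inversion_compl_center {R : ℝ} (hR : R ≠ 0) :
    inversion (0 : E) R '' {0}ᶜ = {0}ᶜ := by
  rw [Set.image_compl_eq (inversion_bijective _ hR), Set.image_singleton, inversion_self]

variable [Nontrivial E] (μ : Measure E) [μ.IsAddHaarMeasure]

lemma restrict_compl_singleton_zero : μ.restrict ({0}ᶜ : Set E) = μ :=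
  Measure.restrict_eq_self_of_ae_mem (by simp [ae_iff])

omit [FiniteDimensional ℝ E] [MeasurableSpace E] [BorelSpace E] [Nontrivial E] in
lemma hasFDerivWithinAt_inversion_zero (R : ℝ) (y : E) (hy : y ∈ ({0}ᶜ : Set E)) :
    HasFDerivWithinAt (inversion (0 : E) R)
      ((R / ‖y‖) ^ 2 • ((ℝ ∙ y)ᗮ.reflection : E →L[ℝ] E)) {0}ᶜ y := by
  have h := (hasFDerivAt_inversion (R := R) (c := (0 : E)) (x := y) hy).hasFDerivWithinAt
    (s := {0}ᶜ)
  simpa using h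

lemma integral_inversion {R : ℝ} (hR : R ≠ 0) (f : E → ℝ) :
    ∫ y, (R / ‖y‖) ^ (2 * Module.finrank ℝ E) * f (inversion 0 R y) ∂μ = ∫ y, f y ∂μ := by
  have h := integral_image_eq_integral_abs_det_fderiv_smul μ
    (measurableSet_singleton (0 : E)).compl (hasFDerivWithinAt_inversion_zero R)
    (inversion_injective _ hR).injOn f
  simp only [image_inversion_compl_center hR, restrict_compl_singleton_zero,
    abs_det_smul_reflection, smul_eq_mul, abs_sq, ← pow_mul] at h
  exact h.symm

lemma integrable_inversion {R : ℝ} (hR : R ≠ 0) {f : E → ℝ} (hf : Integrable f μ) :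
    Integrable (fun y => (R / ‖y‖) ^ (2 * Module.finrank ℝ E) * f (inversion 0 R y)) μ := by
  have h := integrableOn_image_iff_integrableOn_abs_det_fderiv_smul μ
    (measurableSet_singleton (0 : E)).compl (hasFDerivWithinAt_inversion_zero R)
    (inversion_injective _ hR).injOn f
  simp only [image_inversion_compl_center hR, IntegrableOn, restrict_compl_singleton_zero,
    abs_det_smul_reflection, smul_eq_mul, abs_sq, ← pow_mul] at h
  exact h.1 hf

/-- A function whose average with its transform under inversion is nonnegative has nonnegative
integral. -/
lemma integral_nonneg_of_inversion {R : ℝ} (hR : R ≠ 0) {f : E → ℝ}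
    (hf : ∀ y, y ≠ 0 →
      0 ≤ f y + (R / ‖y‖) ^ (2 * Module.finrank ℝ E) * f (inversion 0 R y)) :
    0 ≤ ∫ y, f y ∂μ := by
  by_cases hfi : Integrable f μ
  · have h : 0 ≤ ∫ y, (f y +
        (R / ‖y‖) ^ (2 * Module.finrank ℝ E) * f (inversion 0 R y)) ∂μ := by
      refine integral_nonneg_of_ae ?_
      filter_upwards [Measure.ae_ne μ 0] with y hy using hf y hy
    rw [integral_add hfi (integrable_inversion μ hR hfi), integral_inversion μ hR] at h
    linarith
  · rw [integral_undef hfi]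

end Inversion

section Truncation

variable {E : Type*} [NormedAddCommGroup E]

/-- The region where `‖x - y‖² / (‖x‖ ‖y‖)` lies between `1 / k` and `k`. It is symmetric in `x`
and `y`, and each of its slices is invariant under inversion in the sphere of radius `‖x‖`. -/
def shell (E : Type*) [NormedAddCommGroup E] (k : ℕ) : Set (E × E) :=
  {z | z.1 ≠ 0 ∧ z.2 ≠ 0 ∧ ‖z.1‖ * ‖z.2‖ ≤ k * ‖z.1 - z.2‖ ^ 2 ∧
    ‖z.1 - z.2‖ ^ 2 ≤ k * (‖z.1‖ * ‖z.2‖)}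

lemma swap_mem_shell_iff {k : ℕ} {z : E × E} : z.swap ∈ shell E k ↔ z ∈ shell E k := by
  simp only [shell, Set.mem_ofPred_eq, Prod.fst_swap, Prod.snd_swap, norm_sub_rev z.2,
    mul_comm ‖z.2‖]
  tauto

lemma monotone_shell : Monotone (shell E) := by
  rintro k l hkl z ⟨h1, h2, h3, h4⟩
  have : (k : ℝ) ≤ l := by exact_mod_cast hkl
  exact ⟨h1, h2, h3.trans (by gcongr), h4.trans (by gcongr)⟩

lemma measurableSet_shell [MeasurableSpace E] [BorelSpace E] [SecondCountableTopology E] (k : ℕ) :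
    MeasurableSet (shell E k) := by
  have h1 : MeasurableSet {z : E × E | z.1 ≠ 0} :=
    (measurableSet_singleton (0 : E)).compl.preimage measurable_fst
  have h2 : MeasurableSet {z : E × E | z.2 ≠ 0} :=
    (measurableSet_singleton (0 : E)).compl.preimage measurable_snd
  exact h1.inter (h2.inter ((measurableSet_le
    (f := fun z : E × E => ‖z.1‖ * ‖z.2‖) (g := fun z => k * ‖z.1 - z.2‖ ^ 2)
    (by fun_prop) (by fun_prop)).inter (measurableSet_le
    (f := fun z : E × E => ‖z.1 - z.2‖ ^ 2) (g := fun z => k * (‖z.1‖ * ‖z.2‖))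
    (by fun_prop) (by fun_prop))))

lemma exists_mem_nhds_shell {z : E × E} (h1 : z.1 ≠ 0) (h2 : z.2 ≠ 0) (h3 : z.1 ≠ z.2) :
    ∃ k, shell E k ∈ nhds z := by
  have p1 := norm_pos_iff.2 h1
  have p2 := norm_pos_iff.2 h2
  have p3 := norm_pos_iff.2 (sub_ne_zero.2 h3)
  obtain ⟨k, hk⟩ := exists_nat_gt
    (max ((‖z.1‖ * ‖z.2‖) / ‖z.1 - z.2‖ ^ 2) (‖z.1 - z.2‖ ^ 2 / (‖z.1‖ * ‖z.2‖)))
  rw [max_lt_iff, div_lt_iff₀ (by positivity), div_lt_iff₀ (by positivity)] at hk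
  refine ⟨k, ?_⟩
  filter_upwards [continuousAt_fst.eventually_ne h1, continuousAt_snd.eventually_ne h2,
    (by fun_prop : Continuous fun z : E × E => ‖z.1‖ * ‖z.2‖).continuousAt.eventually_lt
      (by fun_prop : Continuous fun z : E × E => (k : ℝ) * ‖z.1 - z.2‖ ^ 2).continuousAt hk.1,
    (by fun_prop : Continuous fun z : E × E => ‖z.1 - z.2‖ ^ 2).continuousAt.eventually_lt
      (by fun_prop : Continuous fun z : E × E => (k : ℝ) * (‖z.1‖ * ‖z.2‖)).continuousAt hk.2]
    with w a1 a2 a3 a4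
  exact ⟨a1, a2, a3.le, a4.le⟩

lemma norm_fst_le_of_mem_shell {k : ℕ} {z : E × E} (hz : z ∈ shell E k) :
    ‖z.1‖ ≤ (k + 2) * ‖z.2‖ := by
  obtain ⟨h1, h2, -, h4⟩ := hz
  have p1 := norm_pos_iff.2 h1
  have p2 := norm_pos_iff.2 h2
  have h : (‖z.1‖ - ‖z.2‖) ^ 2 ≤ ‖z.1 - z.2‖ ^ 2 := by
    rw [← sq_abs]
    gcongr
    exact abs_norm_sub_norm_le _ _
  by_contra! hlt
  nlinarith [mul_lt_mul_of_pos_left hlt p1, mul_pos p2 p2]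

lemma norm_snd_le_of_mem_shell {k : ℕ} {z : E × E} (hz : z ∈ shell E k) :
    ‖z.2‖ ≤ (k + 2) * ‖z.1‖ :=
  norm_fst_le_of_mem_shell (swap_mem_shell_iff.2 hz)

end Truncation

/-- The density left over after completing the square in the kernel form with respect to the
power `‖x‖ ^ (-p)`. -/
noncomputable def squareDefect {E : Type*} [NormedAddCommGroup E] (b p m : ℝ) (x y : E) : ℝ :=
  (‖x‖ ^ b - (‖x‖ ^ b + ‖y‖ ^ b) / 2 * (‖x‖ / ‖y‖) ^ p) / ‖x - y‖ ^ m

lemma squareDefect_inversion_aux {X Y D a b p : ℝ} {n : ℕ} (hX : 0 < X) (hY : 0 < Y) (hD : 0 < D)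
    (hp : 2 * p = n - a + b) (hp0 : 0 ≤ p) (hbp : b ≤ p) :
    0 ≤ (X ^ b - (X ^ b + Y ^ b) / 2 * (X / Y) ^ p) / D ^ (n + a) + (X / Y) ^ (2 * n) *
      ((X ^ b - (X ^ b + (X ^ 2 / Y) ^ b) / 2 * (X / (X ^ 2 / Y)) ^ p) /
        (X / Y * D) ^ (n + a)) := by
  obtain ⟨r, hr, rfl⟩ : ∃ r, 0 < r ∧ Y = X / r :=
    ⟨X / Y, by positivity, by field_simp⟩
  have e1 : X / (X / r) = r := by field_simp
  have e2 : X ^ 2 / (X / r) = X * r := by field_simp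
  have e3 : X / (X * r) = r⁻¹ := by field_simp
  have e4 : r ^ (2 * n) = r ^ (n + a) * (r ^ p * r ^ p / r ^ b) := by
    rw [← Real.rpow_natCast, ← Real.rpow_add hr, ← Real.rpow_sub hr, ← Real.rpow_add hr]
    congr 1
    push_cast
    linarith
  rw [e1, e2, e3, e4, Real.div_rpow hX.le hr.le, Real.mul_rpow hX.le hr.le, Real.inv_rpow hr.le,
    Real.mul_rpow hr.le hD.le]
  have hpos : 0 ≤ (1 - r ^ p) * (r ^ b - r ^ p) := by
    rcases le_total 1 r with h | h
    · exact mul_nonneg_of_nonpos_of_nonpos (by linarith [Real.one_le_rpow h hp0])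
        (by linarith [Real.rpow_le_rpow_of_exponent_le h hbp])
    · exact mul_nonneg (by linarith [Real.rpow_le_one hr.le h hp0])
        (by linarith [Real.rpow_le_rpow_of_exponent_ge hr h hbp])
  have : 0 < r ^ p := by positivity
  have : 0 < r ^ b := by positivity
  have : 0 < r ^ (n + a) := by positivity
  have : 0 < D ^ (n + a) := by positivity
  have : 0 < X ^ b := by positivity
  generalize r ^ p = P at *
  generalize r ^ b = B at *
  generalize r ^ (n + a) = M at *
  generalize D ^ (n + a) = L at *
  generalize X ^ b = Q at *
  have : (Q - (Q + Q / B) / 2 * P) / L + M * (P * P / B) *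
      ((Q - (Q + Q * B) / 2 * P⁻¹) / (M * L)) = Q / (B * L) * ((1 - P) * (B - P)) := by
    field_simp
    ring
  rw [this]
  positivity

section Defect

open EuclideanGeometry

variable {E : Type*} [NormedAddCommGroup E] [InnerProductSpace ℝ E]

lemma norm_inversion_zero (R : ℝ) (y : E) : ‖inversion 0 R y‖ = R ^ 2 / ‖y‖ := by
  simpa using dist_inversion_center (0 : E) y R

lemma norm_sub_inversion_zero {x y : E} (hx : x ≠ 0) (hy : y ≠ 0) :
    ‖x - inversion 0 ‖x‖ y‖ = ‖x‖ / ‖y‖ * ‖x - y‖ := by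
  have h := dist_inversion_inversion hx hy ‖x‖
  have h2 : inversion 0 ‖x‖ x = x := by simpa using inversion_dist_center (0 : E) x
  rw [h2] at h
  simp only [dist_eq_norm, sub_zero] at h
  rw [h]
  have := norm_pos_iff.2 hx
  field_simp

lemma inversion_mem_shell {k : ℕ} {x y : E} (h : (x, y) ∈ shell E k) :
    (x, inversion 0 ‖x‖ y) ∈ shell E k := by
  obtain ⟨h1, h2, h3, h4⟩ := h
  simp only at h1 h2 h3 h4
  have p1 := norm_pos_iff.2 h1
  have p2 := norm_pos_iff.2 h2
  have e : ‖x‖ * (‖x‖ ^ 2 / ‖y‖) = (‖x‖ / ‖y‖) ^ 2 * (‖x‖ * ‖y‖) := by field_simp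
  refine ⟨h1, by simpa [inversion_eq_center p1.ne'] using h2, ?_, ?_⟩
  · simp only [norm_sub_inversion_zero h1 h2, norm_inversion_zero, e, mul_pow]
    linarith [mul_le_mul_of_nonneg_left h3 (sq_nonneg (‖x‖ / ‖y‖))]
  · simp only [norm_sub_inversion_zero h1 h2, norm_inversion_zero, e, mul_pow]
    linarith [mul_le_mul_of_nonneg_left h4 (sq_nonneg (‖x‖ / ‖y‖))]

lemma inversion_mem_shell_iff {k : ℕ} {x y : E} (hx : x ≠ 0) :
    (x, inversion 0 ‖x‖ y) ∈ shell E k ↔ (x, y) ∈ shell E k := by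
  refine ⟨fun h => ?_, inversion_mem_shell⟩
  have := inversion_mem_shell h
  rwa [inversion_inversion _ (norm_ne_zero_iff.2 hx)] at this

variable [FiniteDimensional ℝ E] [MeasurableSpace E] [BorelSpace E] [Nontrivial E]
  (μ : Measure E) [μ.IsAddHaarMeasure]

lemma integral_indicator_squareDefect_nonneg {a b p : ℝ}
    (hp : 2 * p = Module.finrank ℝ E - a + b) (hp0 : 0 ≤ p) (hbp : b ≤ p) (k : ℕ) (x : E) :
    0 ≤ ∫ y, (shell E k).indicator
      (fun z => squareDefect b p (Module.finrank ℝ E + a) z.1 z.2) (x, y) ∂μ := by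
  rcases eq_or_ne x 0 with rfl | hx
  · simp [shell]
  refine integral_nonneg_of_inversion μ (norm_ne_zero_iff.2 hx) fun y hy => ?_
  by_cases h : (x, y) ∈ shell E k
  · have h' := (inversion_mem_shell_iff hx).2 h
    have hxy : x ≠ y := by
      rintro rfl
      have := h.2.2.1
      simp at this
      nlinarith [norm_pos_iff.2 hx]
    simp only [Set.indicator_of_mem h, Set.indicator_of_mem h', squareDefect,
      norm_sub_inversion_zero hx hy, norm_inversion_zero]
    exact squareDefect_inversion_aux (norm_pos_iff.2 hx) (norm_pos_iff.2 hy)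
      (norm_pos_iff.2 (sub_ne_zero.2 hxy)) hp hp0 hbp
  · have h' := (inversion_mem_shell_iff hx).not.2 h
    simp [Set.indicator_of_notMem h, Set.indicator_of_notMem h']

omit [InnerProductSpace ℝ E] [FiniteDimensional ℝ E] [MeasurableSpace E] [BorelSpace E]
  [Nontrivial E] in
lemma abs_squareDefect_le {b p m : ℝ} (hb : 0 ≤ b) (hp : 0 ≤ p) (hm : 0 ≤ m) {k : ℕ} {x y : E}
    (h : (x, y) ∈ shell E k) :
    |squareDefect b p m x y| ≤ (1 + (k + 2 : ℝ) ^ p) * (k + 2 : ℝ) ^ (b / 2) * (k : ℝ) ^ (m / 2) *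
      (‖x‖ ^ (-((m - b) / 2)) * ‖y‖ ^ (-((m - b) / 2))) := by
  have hxy := norm_fst_le_of_mem_shell h
  have hyx := norm_snd_le_of_mem_shell h
  obtain ⟨h1, h2, h3, h4⟩ := h
  simp only at *
  have p1 := norm_pos_iff.2 h1
  have p2 := norm_pos_iff.2 h2
  unfold squareDefect
  generalize ‖x‖ = X at *
  generalize ‖y‖ = Y at *
  have hD0 := norm_nonneg (x - y)
  generalize ‖x - y‖ = D at *
  have hXY : 0 < X * Y := by positivity
  have hk : (0 : ℝ) < k := by
    by_contra! hk
    nlinarith [mul_nonneg_of_nonpos_of_nonpos hk (neg_nonpos.2 (sq_nonneg D))]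
  have hX : X ^ b ≤ (k + 2 : ℝ) ^ (b / 2) * (X * Y) ^ (b / 2) := by
    rw [← Real.mul_rpow (by positivity) hXY.le, show X ^ b = (X ^ 2) ^ (b / 2) by
      rw [← Real.rpow_natCast, ← Real.rpow_mul p1.le]; congr 1; push_cast; ring]
    exact Real.rpow_le_rpow (by positivity) (by nlinarith) (by positivity)
  have hY : Y ^ b ≤ (k + 2 : ℝ) ^ (b / 2) * (X * Y) ^ (b / 2) := by
    rw [← Real.mul_rpow (by positivity) hXY.le, show Y ^ b = (Y ^ 2) ^ (b / 2) by
      rw [← Real.rpow_natCast, ← Real.rpow_mul p2.le]; congr 1; push_cast; ring]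
    exact Real.rpow_le_rpow (by positivity) (by nlinarith) (by positivity)
  have hr : (X / Y) ^ p ≤ (k + 2 : ℝ) ^ p :=
    Real.rpow_le_rpow (by positivity) ((div_le_iff₀ p2).2 hxy) hp
  have hD : (X * Y) ^ (m / 2) / (k : ℝ) ^ (m / 2) ≤ D ^ m := by
    rw [← Real.div_rpow hXY.le hk.le, show D ^ m = (D ^ 2) ^ (m / 2) by
      rw [← Real.rpow_natCast, ← Real.rpow_mul hD0]; congr 1; push_cast; ring]
    exact Real.rpow_le_rpow (by positivity) ((div_le_iff₀ hk).2 (by linarith)) (by positivity)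
  have hnum : |X ^ b - (X ^ b + Y ^ b) / 2 * (X / Y) ^ p| ≤
      (1 + (k + 2 : ℝ) ^ p) * ((k + 2 : ℝ) ^ (b / 2) * (X * Y) ^ (b / 2)) := by
    have q1 : 0 ≤ X ^ b := by positivity
    have q2 : 0 ≤ Y ^ b := by positivity
    have q3 : 0 ≤ (X / Y) ^ p := by positivity
    have : (X ^ b + Y ^ b) / 2 * (X / Y) ^ p ≤
        ((k + 2 : ℝ) ^ (b / 2) * (X * Y) ^ (b / 2)) * (k + 2 : ℝ) ^ p :=
      mul_le_mul (by linarith) hr q3 (by positivity)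
    have : 0 ≤ (X ^ b + Y ^ b) / 2 * (X / Y) ^ p := by positivity
    rw [abs_le]
    constructor <;> nlinarith
  have hD' : 0 ≤ D ^ m := by positivity
  rw [abs_div, abs_of_nonneg hD']
  calc _ ≤ (1 + (k + 2 : ℝ) ^ p) * ((k + 2 : ℝ) ^ (b / 2) * (X * Y) ^ (b / 2)) /
        ((X * Y) ^ (m / 2) / (k : ℝ) ^ (m / 2)) := by gcongr
    _ = _ := by
      rw [← Real.mul_rpow p1.le p2.le, show -((m - b) / 2) = b / 2 - m / 2 by ring,
        Real.rpow_sub hXY]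
      field_simp

lemma integrableOn_mul_squareDefect {a b p : ℝ} (hb : 0 ≤ b) (hp : 0 ≤ p)
    (ha : 0 ≤ a) (hab : a < Module.finrank ℝ E + b) {f : E → ℝ} (hf : Continuous f)
    (hfs : HasCompactSupport f) (k : ℕ) :
    IntegrableOn (fun z : E × E =>
      f z.1 * squareDefect b p (Module.finrank ℝ E + a) z.1 z.2) (shell E k) (μ.prod μ) := by
  obtain ⟨C, hC⟩ := hf.bounded_above_of_compact_support hfs
  obtain ⟨R, hR⟩ := hfs.isCompact.isBounded.subset_ball 0
  set m : ℝ := Module.finrank ℝ E + a with hm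
  set s : ℝ := -((m - b) / 2) with hs
  have hint (R : ℝ) : Integrable ((Metric.ball (0 : E) R).indicator fun x => ‖x‖ ^ s) μ :=
    (integrable_indicator_iff Metric.isOpen_ball.measurableSet).2
      (integrableOn_ball_norm_rpow μ (by rw [hs, hm]; linarith) R)
  have hprod := (((hint R).mul_prod (hint ((k + 2) * R))).const_mul
    (C * ((1 + (k + 2 : ℝ) ^ p) * (k + 2 : ℝ) ^ (b / 2) * (k : ℝ) ^ (m / 2)))).integrableOn
    (s := shell E k)
  refine Integrable.mono' hprod ?_ ?_
  · have := hf.measurable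
    have : Measurable (fun z : E × E => f z.1 * squareDefect b p m z.1 z.2) := by
      unfold squareDefect
      fun_prop
    exact this.aestronglyMeasurable
  · refine (ae_restrict_iff' (measurableSet_shell k)).2 (Filter.Eventually.of_forall ?_)
    rintro ⟨x, y⟩ hz
    simp only
    by_cases hx : f x = 0
    · have hC0 : 0 ≤ C := (norm_nonneg _).trans (hC 0)
      rw [hx, zero_mul, norm_zero]
      have hind (S : ℝ) (x : E) : 0 ≤ (Metric.ball (0 : E) S).indicator (fun x => ‖x‖ ^ s) x :=
        Set.indicator_nonneg (fun _ _ => by positivity) _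
      have := hind R x
      have := hind ((k + 2) * R) y
      positivity
    · have hxR : x ∈ Metric.ball (0 : E) R := hR (subset_tsupport _ hx)
      have hyR : y ∈ Metric.ball (0 : E) ((k + 2) * R) := by
        rw [mem_ball_zero_iff] at hxR ⊢
        refine (norm_snd_le_of_mem_shell hz).trans_lt ?_
        simp only
        gcongr
      rw [Set.indicator_of_mem hxR, Set.indicator_of_mem hyR, norm_mul, mul_assoc C]
      exact mul_le_mul (hC x) (abs_squareDefect_le hb hp (by positivity) hz) (norm_nonneg _)
        ((norm_nonneg _).trans (hC x))

lemma setIntegral_shell_mul_squareDefect_nonneg {a b p : ℝ} (hb : 0 ≤ b)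
    (hp : 2 * p = Module.finrank ℝ E - a + b) (hp0 : 0 ≤ p) (hbp : b ≤ p)
    (ha : 0 ≤ a) (hab : a < Module.finrank ℝ E + b) {f : E → ℝ} (hf : Continuous f)
    (hfs : HasCompactSupport f) (hf0 : ∀ x, 0 ≤ f x) (k : ℕ) :
    0 ≤ ∫ z in shell E k,
      f z.1 * squareDefect b p (Module.finrank ℝ E + a) z.1 z.2 ∂(μ.prod μ) := by
  have hint := integrableOn_mul_squareDefect μ hb hp0 ha hab hf hfs k
  rw [← integral_indicator (measurableSet_shell k), integral_prod _
    ((integrable_indicator_iff (measurableSet_shell k)).2 hint)]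
  refine integral_nonneg fun x => ?_
  simp_rw [Set.indicator_mul_right _ (fun z : E × E => f z.1)
    (fun z : E × E => squareDefect b p (Module.finrank ℝ E + a) z.1 z.2)]
  rw [integral_const_mul]
  exact mul_nonneg (hf0 x) (integral_indicator_squareDefect_nonneg μ hp hp0 hbp k x)

end Defect

section KernelIntegrand

variable {E : Type*} [NormedAddCommGroup E]

/-- The integrand of the kernel form, as a function on the product space. -/
noncomputable def kernelIntegrand (b m : ℝ) (ψ : E → ℂ) (z : E × E) : ℂ :=
  (((starRingEnd ℂ) (ψ z.1) - (starRingEnd ℂ) (ψ z.2)) *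
    ((‖z.1‖ ^ b : ℝ) • ψ z.1 - (‖z.2‖ ^ b : ℝ) • ψ z.2)) /
    (Complex.ofReal (‖z.1 - z.2‖ ^ m))

lemma norm_kernelIntegrand (b m : ℝ) (ψ : E → ℂ) (x y : E) :
    ‖kernelIntegrand b m ψ (x, y)‖ = ‖ψ x - ψ y‖ *
      ‖(‖x‖ ^ b : ℝ) • ψ x - (‖y‖ ^ b : ℝ) • ψ y‖ / ‖x - y‖ ^ m := by
  simp only [kernelIntegrand]
  rw [norm_div, norm_mul, ← map_sub, RCLike.norm_conj, Complex.norm_real,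
    Real.norm_of_nonneg (by positivity : 0 ≤ ‖x - y‖ ^ m)]

lemma re_kernelIntegrand (b m : ℝ) (ψ : E → ℂ) (x y : E) :
    (kernelIntegrand b m ψ (x, y)).re = (‖x‖ ^ b * ‖ψ x‖ ^ 2 + ‖y‖ ^ b * ‖ψ y‖ ^ 2 -
      (‖x‖ ^ b + ‖y‖ ^ b) * ((starRingEnd ℂ) (ψ x) * ψ y).re) / ‖x - y‖ ^ m := by
  simp only [kernelIntegrand, Complex.div_ofReal_re, Complex.sq_norm, Complex.normSq_apply]
  congr 1
  simp
  ring

lemma re_kernelIntegrand_sub {b p m : ℝ} (ψ : E → ℂ) (x y : E) :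
    (kernelIntegrand b m ψ (x, y)).re - ‖ψ x‖ ^ 2 * squareDefect b p m x y -
      ‖ψ y‖ ^ 2 * squareDefect b p m y x =
    (‖x‖ ^ b + ‖y‖ ^ b) / ‖x - y‖ ^ m * ((‖x‖ / ‖y‖) ^ p * ‖ψ x‖ ^ 2 / 2 +
      (‖y‖ / ‖x‖) ^ p * ‖ψ y‖ ^ 2 / 2 - ((starRingEnd ℂ) (ψ x) * ψ y).re) := by
  rw [re_kernelIntegrand, squareDefect, squareDefect, norm_sub_rev y x]
  ring

lemma re_kernelIntegrand_sub_nonneg {b p m : ℝ} (ψ : E → ℂ) {x y : E} (hx : x ≠ 0) (hy : y ≠ 0) :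
    0 ≤ (kernelIntegrand b m ψ (x, y)).re - ‖ψ x‖ ^ 2 * squareDefect b p m x y -
      ‖ψ y‖ ^ 2 * squareDefect b p m y x := by
  rw [re_kernelIntegrand_sub]
  have p1 := norm_pos_iff.2 hx
  have p2 := norm_pos_iff.2 hy
  refine mul_nonneg (by positivity) ?_
  have hre : ((starRingEnd ℂ) (ψ x) * ψ y).re ≤ ‖ψ x‖ * ‖ψ y‖ := by
    refine (Complex.re_le_norm _).trans_eq ?_
    rw [norm_mul, RCLike.norm_conj]
  have hP : 0 < (‖x‖ / ‖y‖) ^ p := by positivity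
  have hinv : (‖y‖ / ‖x‖) ^ p = ((‖x‖ / ‖y‖) ^ p)⁻¹ := by
    rw [← Real.inv_rpow (by positivity), inv_div]
  rw [hinv]
  generalize (‖x‖ / ‖y‖) ^ p = P at *
  have : P * ‖ψ x‖ ^ 2 / 2 + P⁻¹ * ‖ψ y‖ ^ 2 / 2 - ‖ψ x‖ * ‖ψ y‖ =
      P⁻¹ / 2 * (P * ‖ψ x‖ - ‖ψ y‖) ^ 2 := by
    field_simp
    ring
  have : 0 ≤ P⁻¹ / 2 * (P * ‖ψ x‖ - ‖ψ y‖) ^ 2 := by positivity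
  linarith

lemma re_kernelIntegrand_sub_pos {b p m : ℝ} {ψ : E → ℂ} {x y : E} (hx : x ≠ 0) (hy : y ≠ 0)
    (hψx : ψ x ≠ 0) (hψy : ψ y = 0) :
    0 < (kernelIntegrand b m ψ (x, y)).re - ‖ψ x‖ ^ 2 * squareDefect b p m x y -
      ‖ψ y‖ ^ 2 * squareDefect b p m y x := by
  rw [re_kernelIntegrand_sub, hψy]
  have p1 := norm_pos_iff.2 hx
  have p2 := norm_pos_iff.2 hy
  have p3 := norm_pos_iff.2 hψx
  have hxy : x ≠ y := by
    rintro rfl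
    exact hψx hψy
  have p4 := norm_pos_iff.2 (sub_ne_zero.2 hxy)
  simp
  positivity

lemma norm_kernelIntegrand_le {b m R C L : ℝ} (hb : 0 < b) (hR : 0 < R)
    {ψ : E → ℂ} (hC : ∀ x, ‖ψ x‖ ≤ C) (hL : ∀ x y, ‖ψ x - ψ y‖ ≤ L * ‖x - y‖) (hL0 : 0 ≤ L)
    (hsupp : ∀ x, R ≤ ‖x‖ → ψ x = 0) {x : E} (hx : x ≠ 0) (y : E) :
    ‖kernelIntegrand b m ψ (x, y)‖ ≤
      L * (2 * R * L + C * (1 + b)) *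
        ((Metric.ball (0 : E) (2 * R)).indicator (fun x => ‖x‖ ^ (b - 1) + (2 * R) ^ (b - 1)) x *
        (Metric.ball (0 : E) (4 * R)).indicator (fun w => ‖w‖ ^ (2 - m)) (x - y)) +
      C ^ 2 * R ^ b * ((Metric.ball (0 : E) R).indicator (fun _ => (1 : ℝ)) x *
        (Metric.closedBall (0 : E) R)ᶜ.indicator (fun w => ‖w‖ ^ (-m)) (x - y)) +
      C ^ 2 * R ^ b * ((Metric.ball (0 : E) R).indicator (fun _ => (1 : ℝ)) y *
        (Metric.closedBall (0 : E) R)ᶜ.indicator (fun w => ‖w‖ ^ (-m)) (y - x)) := by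
  have hC0 : 0 ≤ C := (norm_nonneg _).trans (hC 0)
  have hind (s : Set E) (f : E → ℝ) (hf : ∀ x, 0 ≤ f x) (x : E) : 0 ≤ s.indicator f x :=
    Set.indicator_nonneg (fun x _ => hf x) x
  have n1 := hind (Metric.ball (0 : E) (2 * R)) (fun x => ‖x‖ ^ (b - 1) + (2 * R) ^ (b - 1))
    (fun x => by positivity) x
  have n2 := hind (Metric.ball (0 : E) (4 * R)) (fun w => ‖w‖ ^ (2 - m))
    (fun x => by positivity) (x - y)
  have n3 (x : E) := hind (Metric.ball (0 : E) R) (fun _ => (1 : ℝ)) (fun x => by positivity) x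
  have n4 (x : E) := hind (Metric.closedBall (0 : E) R)ᶜ (fun w => ‖w‖ ^ (-m))
    (fun x => by positivity) x
  have m1 := mul_nonneg (by positivity : 0 ≤ L * (2 * R * L + C * (1 + b))) (mul_nonneg n1 n2)
  have m2 := mul_nonneg (by positivity : 0 ≤ C ^ 2 * R ^ b) (mul_nonneg (n3 x) (n4 (x - y)))
  have m3 := mul_nonneg (by positivity : 0 ≤ C ^ 2 * R ^ b) (mul_nonneg (n3 y) (n4 (y - x)))
  have far {u v : E} (hu : ‖u‖ < R) (hv : 2 * R ≤ ‖v‖) :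
      ‖ψ u‖ * (‖u‖ ^ b * ‖ψ u‖) / ‖u - v‖ ^ m ≤
      C ^ 2 * R ^ b * ((Metric.ball (0 : E) R).indicator (fun _ => (1 : ℝ)) u *
        (Metric.closedBall (0 : E) R)ᶜ.indicator (fun w => ‖w‖ ^ (-m)) (u - v)) := by
    have huv : R < ‖u - v‖ := by
      have := norm_sub_norm_le v u
      rw [norm_sub_rev] at this
      linarith
    rw [Set.indicator_of_mem (by simpa using hu), Set.indicator_of_mem (by simpa using huv),
      one_mul, Real.rpow_neg (norm_nonneg _), div_eq_mul_inv]
    refine mul_le_mul_of_nonneg_right ?_ (by positivity)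
    calc ‖ψ u‖ * (‖u‖ ^ b * ‖ψ u‖) ≤ C * (R ^ b * C) := by
          gcongr <;> exact hC u
      _ = C ^ 2 * R ^ b := by ring
  rw [norm_kernelIntegrand]
  rcases le_or_gt (2 * R) ‖x‖ with hxR | hxR
  · rw [hsupp x (by linarith)]
    rcases le_or_gt R ‖y‖ with hyR | hyR
    · rw [hsupp y hyR]
      simp only [sub_self, norm_zero, zero_mul, zero_div]
      linarith
    · have := far hyR hxR
      simp only [zero_sub, norm_neg, smul_zero, norm_smul]
      rw [Real.norm_of_nonneg (by positivity), norm_sub_rev x y]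
      linarith
  rcases le_or_gt (2 * R) ‖y‖ with hyR | hyR
  · rw [hsupp y (by linarith)]
    rcases le_or_gt R ‖x‖ with hxR | hxR
    · rw [hsupp x hxR]
      simp only [sub_self, norm_zero, zero_mul, zero_div]
      linarith
    · have := far hxR hyR
      simp only [sub_zero, smul_zero, norm_smul]
      rw [Real.norm_of_nonneg (by positivity)]
      linarith
  rcases eq_or_ne x y with rfl | hxy
  · simp only [sub_self, norm_zero, zero_mul, zero_div] at *
    linarith
  have hd : 0 < ‖x - y‖ := norm_pos_iff.2 (sub_ne_zero.2 hxy)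
  have hd4 : ‖x - y‖ < 4 * R := (norm_sub_le _ _).trans_lt (by linarith)
  have hX := norm_pos_iff.2 hx
  set M := max ‖x‖ ‖y‖ with hM
  have hM0 : 0 < M := hX.trans_le (le_max_left _ _)
  have hM2 : M < 2 * R := max_lt hxR hyR
  have hMpow : M ^ (b - 1) ≤ ‖x‖ ^ (b - 1) + (2 * R) ^ (b - 1) := by
    rcases le_total 1 b with h | h
    · have := Real.rpow_le_rpow hM0.le hM2.le (sub_nonneg.2 h)
      have : 0 ≤ ‖x‖ ^ (b - 1) := by positivity
      linarith
    · have := Real.rpow_le_rpow_of_nonpos hX (le_max_left ‖x‖ ‖y‖) (sub_nonpos.2 h)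
      have : 0 ≤ (2 * R) ^ (b - 1) := by positivity
      linarith
  have hxb : ‖x‖ ^ b ≤ 2 * R * M ^ (b - 1) := by
    calc ‖x‖ ^ b ≤ M ^ b := Real.rpow_le_rpow hX.le (le_max_left _ _) hb.le
      _ = M * M ^ (b - 1) := by rw [mul_comm, ← Real.rpow_add_one hM0.ne', sub_add_cancel]
      _ ≤ 2 * R * M ^ (b - 1) := by gcongr
  have hdiff : ‖(‖x‖ ^ b : ℝ) • ψ x - (‖y‖ ^ b : ℝ) • ψ y‖ ≤
      (2 * R * L + C * (1 + b)) * M ^ (b - 1) * ‖x - y‖ := by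
    calc ‖(‖x‖ ^ b : ℝ) • ψ x - (‖y‖ ^ b : ℝ) • ψ y‖
        = ‖(‖x‖ ^ b : ℝ) • (ψ x - ψ y) + (‖x‖ ^ b - ‖y‖ ^ b : ℝ) • ψ y‖ := by
          congr 1
          rw [smul_sub, sub_smul]
          abel
      _ ≤ ‖x‖ ^ b * ‖ψ x - ψ y‖ + |‖x‖ ^ b - ‖y‖ ^ b| * ‖ψ y‖ := by
          refine (norm_add_le _ _).trans_eq ?_
          rw [norm_smul, norm_smul, Real.norm_of_nonneg (by positivity), Real.norm_eq_abs]
      _ ≤ 2 * R * M ^ (b - 1) * (L * ‖x - y‖) + (1 + b) * M ^ (b - 1) * ‖x - y‖ * C := by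
          gcongr
          · exact hL x y
          · exact (abs_rpow_sub_rpow_le_max hX (norm_nonneg y) hb).trans
              (by gcongr; exact abs_norm_sub_norm_le _ _)
          · exact hC y
      _ = _ := by ring
  have hpow : ‖x - y‖ ^ (2 - m) = ‖x - y‖ * ‖x - y‖ / ‖x - y‖ ^ m := by
    rw [Real.rpow_sub hd, Real.rpow_two, sq]
  calc ‖ψ x - ψ y‖ * ‖(‖x‖ ^ b : ℝ) • ψ x - (‖y‖ ^ b : ℝ) • ψ y‖ / ‖x - y‖ ^ m
      ≤ (L * ‖x - y‖) * ((2 * R * L + C * (1 + b)) *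
          (‖x‖ ^ (b - 1) + (2 * R) ^ (b - 1)) * ‖x - y‖) / ‖x - y‖ ^ m := by
        gcongr
        · exact hL x y
        · exact hdiff.trans (by gcongr)
    _ = L * (2 * R * L + C * (1 + b)) *
        ((‖x‖ ^ (b - 1) + (2 * R) ^ (b - 1)) * ‖x - y‖ ^ (2 - m)) := by
        rw [hpow]
        ring
    _ ≤ _ := by
        rw [Set.indicator_of_mem (by simpa using hxR), Set.indicator_of_mem (by simpa using hd4)]
        linarith

end KernelIntegrand

section Positivity

variable {E : Type*} [NormedAddCommGroup E] [InnerProductSpace ℝ E] [FiniteDimensional ℝ E]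
  [MeasurableSpace E] [BorelSpace E] [Nontrivial E] (μ : Measure E) [μ.IsAddHaarMeasure]

lemma integrable_kernelIntegrand {a b : ℝ} (ha : a ∈ Set.Ioo (0 : ℝ) 2) (hb : 0 < b)
    {ψ : E → ℂ} (hψ : ContDiff ℝ 1 ψ) (hsupp : HasCompactSupport ψ) :
    Integrable (kernelIntegrand b (Module.finrank ℝ E + a) ψ) (μ.prod μ) := by
  obtain ⟨C, hC⟩ := hψ.continuous.bounded_above_of_compact_support hsupp
  obtain ⟨L, hL⟩ := hψ.lipschitzWith_of_hasCompactSupport hsupp one_ne_zero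
  obtain ⟨R, hR0, hR⟩ := hsupp.isCompact.isBounded.subset_ball_lt 0 0
  have hR' (x : E) (hx : R ≤ ‖x‖) : ψ x = 0 := by
    by_contra h
    have := hR (subset_tsupport _ h)
    rw [mem_ball_zero_iff] at this
    linarith
  obtain ⟨ha0, ha2⟩ := ha
  have hn : (1 : ℝ) ≤ Module.finrank ℝ E := by exact_mod_cast Module.finrank_pos (R := ℝ) (M := E)
  set m : ℝ := Module.finrank ℝ E + a with hm
  have i1 : Integrable ((Metric.ball (0 : E) (2 * R)).indicator
      fun x => ‖x‖ ^ (b - 1) + (2 * R) ^ (b - 1)) μ :=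
    (integrable_indicator_iff Metric.isOpen_ball.measurableSet).2
      ((integrableOn_ball_norm_rpow μ (by linarith) _).add
        (integrableOn_const Metric.isBounded_ball.measure_lt_top.ne))
  have i2 : Integrable ((Metric.ball (0 : E) (4 * R)).indicator fun w => ‖w‖ ^ (2 - m)) μ :=
    (integrable_indicator_iff Metric.isOpen_ball.measurableSet).2
      (integrableOn_ball_norm_rpow μ (by linarith) _)
  have i3 : Integrable ((Metric.ball (0 : E) R).indicator fun _ => (1 : ℝ)) μ :=
    (integrable_indicator_iff Metric.isOpen_ball.measurableSet).2
      (integrableOn_const Metric.isBounded_ball.measure_lt_top.ne)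
  have i4 : Integrable ((Metric.closedBall (0 : E) R)ᶜ.indicator fun w => ‖w‖ ^ (-m)) μ :=
    (integrable_indicator_iff Metric.isClosed_closedBall.measurableSet.compl).2
      (integrableOn_compl_closedBall_norm_rpow μ (by linarith) hR0)
  have i5 := Integrable.mul_prod_sub i3 i4
  refine Integrable.mono' ((((Integrable.mul_prod_sub i1 i2).const_mul
    (L * (2 * R * L + C * (1 + b)))).add (i5.const_mul (C ^ 2 * R ^ b))).add
    (i5.swap.const_mul (C ^ 2 * R ^ b))) ?_ ?_
  · have h := hψ.continuous.measurable
    have h1 : Measurable fun z : E × E => (starRingEnd ℂ) (ψ z.1) :=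
      Complex.continuous_conj.measurable.comp (h.comp measurable_fst)
    have h2 : Measurable fun z : E × E => (starRingEnd ℂ) (ψ z.2) :=
      Complex.continuous_conj.measurable.comp (h.comp measurable_snd)
    have : Measurable (kernelIntegrand b m ψ) := by
      unfold kernelIntegrand
      fun_prop
    exact this.aestronglyMeasurable
  · have hne : ∀ᵐ z : E × E ∂μ.prod μ, z.1 ≠ 0 :=
      Measure.quasiMeasurePreserving_fst.ae (Measure.ae_ne μ 0)
    filter_upwards [hne] with z hz
    exact norm_kernelIntegrand_le hb hR0 hC
      (fun x y => by simpa [dist_eq_norm] using hL.dist_le_mul x y) L.2 hR' hz z.2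

lemma iUnion_shell_ae_eq_univ : ∀ᵐ z : E × E ∂μ.prod μ, z ∈ ⋃ k, shell E k := by
  have h1 : ∀ᵐ z : E × E ∂μ.prod μ, z.1 ≠ 0 :=
    Measure.quasiMeasurePreserving_fst.ae (Measure.ae_ne μ 0)
  have h2 : ∀ᵐ z : E × E ∂μ.prod μ, z.2 ≠ 0 :=
    Measure.quasiMeasurePreserving_snd.ae (Measure.ae_ne μ 0)
  have h3 : ∀ᵐ z : E × E ∂μ.prod μ, z.2 - z.1 ≠ 0 :=
    ((Measure.quasiMeasurePreserving_snd (μ := μ) (ν := μ)).comp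
      (measurePreserving_prod_sub μ μ).quasiMeasurePreserving).ae (Measure.ae_ne μ 0)
  filter_upwards [h1, h2, h3] with z h1 h2 h3
  obtain ⟨k, hk⟩ := exists_mem_nhds_shell h1 h2 (sub_ne_zero.1 h3).symm
  exact Set.mem_iUnion.2 ⟨k, mem_of_mem_nhds hk⟩

theorem integral_re_kernelIntegrand_pos {a b : ℝ} (ha : a ∈ Set.Ioo (0 : ℝ) 2) (hb : 0 < b)
    (hab : a + b ≤ Module.finrank ℝ E) {ψ : E → ℂ} (hψ : ContDiff ℝ 1 ψ)
    (hsupp : HasCompactSupport ψ) (hne : ψ ≠ 0) :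
    0 < ∫ z, (kernelIntegrand b (Module.finrank ℝ E + a) ψ z).re ∂(μ.prod μ) := by
  have hint : Integrable (fun z => (kernelIntegrand b (Module.finrank ℝ E + a) ψ z).re)
    (μ.prod μ) := (integrable_kernelIntegrand μ ha hb hψ hsupp).re
  obtain ⟨p, hp⟩ : ∃ p : ℝ, 2 * p = Module.finrank ℝ E - a + b :=
    ⟨(Module.finrank ℝ E - a + b) / 2, by ring⟩
  obtain ⟨ha0, ha2⟩ := ha
  have hp0 : 0 ≤ p := by linarith
  have hbp : b ≤ p := by linarith
  set m : ℝ := Module.finrank ℝ E + a with hm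
  set f : E → ℝ := fun x => ‖ψ x‖ ^ 2 with hf
  have hfc : Continuous f := hψ.continuous.norm.pow 2
  have hfs : HasCompactSupport f := hsupp.comp_left (g := fun w : ℂ => ‖w‖ ^ 2) (by simp)
  set G : E × E → ℝ := fun z => f z.1 * squareDefect b p m z.1 z.2 with hG
  set S : E × E → ℝ := fun z => (kernelIntegrand b m ψ z).re - G z - G z.swap with hS
  have hGi (k : ℕ) : IntegrableOn G (shell E k) (μ.prod μ) :=
    integrableOn_mul_squareDefect μ hb.le hp0 ha0.le (by linarith) hfc hfs k
  have hswap (k : ℕ) : Prod.swap ⁻¹' shell E k = shell E k := Set.ext fun z => swap_mem_shell_iff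
  have hmp : MeasurePreserving (Prod.swap : E × E → E × E) (μ.prod μ) (μ.prod μ) :=
    Measure.measurePreserving_swap
  have hGi' (k : ℕ) : IntegrableOn (fun z => G z.swap) (shell E k) (μ.prod μ) := by
    have := (hmp.integrableOn_comp_preimage
      MeasurableEquiv.prodComm.measurableEmbedding (f := G) (s := shell E k)).2 (hGi k)
    rwa [hswap] at this
  have hSi (k : ℕ) : IntegrableOn S (shell E k) (μ.prod μ) :=
    (hint.integrableOn.sub (hGi k)).sub (hGi' k)
  have hG0 (k : ℕ) : 0 ≤ ∫ z in shell E k, G z ∂(μ.prod μ) :=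
    setIntegral_shell_mul_squareDefect_nonneg μ hb.le hp hp0 hbp ha0.le (by linarith) hfc hfs
      (fun x => by positivity) k
  have hG0' (k : ℕ) : 0 ≤ ∫ z in shell E k, G z.swap ∂(μ.prod μ) := by
    have := hmp.setIntegral_preimage_emb MeasurableEquiv.prodComm.measurableEmbedding G (shell E k)
    rw [hswap] at this
    rw [this]
    exact hG0 k
  have hS0 (k : ℕ) : ∀ z ∈ shell E k, 0 ≤ S z :=
    fun z hz => re_kernelIntegrand_sub_nonneg ψ hz.1 hz.2.1
  have hle (k : ℕ) : ∫ z in shell E k, S z ∂(μ.prod μ) ≤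
      ∫ z in shell E k, (kernelIntegrand b m ψ z).re ∂(μ.prod μ) := by
    have h1 := integral_sub (hint.integrableOn.sub (hGi k)) (hGi' k)
    have h2 := integral_sub hint.integrableOn (hGi k)
    simp only [Pi.sub_apply] at h1
    simp only [hS]
    linarith [hG0 k, hG0' k]
  have htend := tendsto_setIntegral_of_monotone (measurableSet_shell (E := E)) monotone_shell
    (hint.integrableOn (s := ⋃ k, shell E k))
  rw [Measure.restrict_eq_self_of_ae_mem (iUnion_shell_ae_eq_univ μ)] at htend
  obtain ⟨R, hR0, hR⟩ := hsupp.isCompact.isBounded.subset_ball_lt 0 0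
  obtain ⟨x₀, hx₀, hψ₀⟩ : ∃ x, x ≠ 0 ∧ ψ x ≠ 0 := by
    by_contra! h
    exact hne ((hψ.continuous.ext_on (dense_compl_singleton (0 : E)) continuous_const h))
  obtain ⟨y₀, hy₀⟩ := NormedSpace.exists_lt_norm ℝ E R
  have hzero {y : E} (hy : R < ‖y‖) : ψ y = 0 := by
    by_contra h
    have := hR (subset_tsupport _ h)
    rw [mem_ball_zero_iff] at this
    linarith
  have hxy : x₀ ≠ y₀ := by
    rintro rfl
    exact hψ₀ (hzero hy₀)
  obtain ⟨k₀, hk₀⟩ := exists_mem_nhds_shell (z := (x₀, y₀)) hx₀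
    (norm_pos_iff.1 (hR0.trans hy₀)) hxy
  have hpos : 0 < ∫ z in shell E k₀, S z ∂(μ.prod μ) := by
    rw [setIntegral_pos_iff_support_of_nonneg_ae _ (hSi k₀)]
    · refine Measure.measure_pos_of_mem_nhds _ (x := (x₀, y₀)) (Filter.inter_mem ?_ hk₀)
      filter_upwards [hk₀, (hψ.continuous.comp continuous_fst).continuousAt.eventually_ne hψ₀,
        continuousAt_const.eventually_lt (continuous_snd.norm.continuousAt) hy₀] with z h1 h2 h3
      exact (re_kernelIntegrand_sub_pos h1.1 h1.2.1 h2 (hzero h3)).ne'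
    · exact (ae_restrict_iff' (measurableSet_shell k₀)).2
        (Filter.Eventually.of_forall (hS0 k₀))
  refine hpos.trans_le (ge_of_tendsto htend ?_)
  filter_upwards [Filter.eventually_ge_atTop k₀] with k hk
  refine le_trans ?_ (hle k)
  exact setIntegral_mono_set (hSi k) ((ae_restrict_iff' (measurableSet_shell k)).2
    (Filter.Eventually.of_forall (hS0 k))) (monotone_shell hk).eventuallyLE

end Positivity

lemma alphaConst_pos {n : ℕ} {a : ℝ} (ha : a ∈ Set.Ioo (0 : ℝ) 2) : 0 < alphaConst n a := by
  obtain ⟨ha0, ha2⟩ := ha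
  have h1 : 0 < Real.Gamma (((n : ℝ) + a) / 2) := Real.Gamma_pos_of_pos (by positivity)
  have h2 : Real.Gamma (-a / 2) ≠ 0 := by
    refine Real.Gamma_ne_zero fun k hk => ?_
    rcases k with _ | k
    · simp at hk
      linarith
    · push_cast at hk
      have : (0 : ℝ) ≤ k := k.cast_nonneg
      linarith
  unfold alphaConst
  positivity

/-- Strict positivity of the kernel form of the Jordan product for `a ∈ (0,2)`,
`b > 0`, `a + b ≤ n` and nonzero `ψ ∈ C₀^∞(ℝⁿ)`. -/
theorem kernelForm_pos
    (n : ℕ) (hn : 0 < n) (a b : ℝ) (ha : a ∈ Set.Ioo (0 : ℝ) 2) (hb : 0 < b)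
    (hab : a + b ≤ (n : ℝ))
    (ψ : EuclideanSpace ℝ (Fin n) → ℂ)
    (hsmooth : ContDiff ℝ (⊤ : ℕ∞) ψ) (hsupp : HasCompactSupport ψ) (hne : ψ ≠ 0) :
    0 < kernelForm n a b ψ := by
  have : Nonempty (Fin n) := ⟨⟨0, hn⟩⟩
  have hψ : ContDiff ℝ 1 ψ := hsmooth.of_le (by exact_mod_cast le_top)
  have hint := integrable_kernelIntegrand volume ha hb hψ hsupp
  have hpos := integral_re_kernelIntegrand_pos volume ha hb (by simpa using hab) hψ hsupp hne
  simp only [finrank_euclideanSpace, Fintype.card_fin] at hint hpos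
  have hre : ∫ z, (kernelIntegrand b (n + a) ψ z).re ∂(volume.prod volume) =
      (∫ z, kernelIntegrand b (n + a) ψ z ∂(volume.prod volume)).re := by
    simpa using integral_re hint
  refine mul_pos (alphaConst_pos ha) ?_
  rw [hre, integral_prod _ hint] at hpos
  exact hpos
end

section
/- Let n ≥ 3 be an integer and 0 < b ≤ n − 2. Then for every nonzero smooth compactly supported ψ : ℝⁿ → ℂ, Re ∫_{ℝⁿ} conj(∇ψ(x)) · ∇(|x|^b ψ(x)) dx > 0. (This is the positivity of ½(|p|²|q|^b + |q|^b|p|²).) -/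
open MeasureTheory Real

/-- The sesquilinear gradient form `Re ∫ conj(∇ψ(x)) · ∇φ(x) dx`. -/
noncomputable def gradForm (n : ℕ) (ψ φ : EuclideanSpace ℝ (Fin n) → ℂ) : ℝ :=
  (∫ x : EuclideanSpace ℝ (Fin n),
      ∑ i : Fin n,
        (starRingEnd ℂ) (fderiv ℝ ψ x (EuclideanSpace.single i 1)) *
          fderiv ℝ φ x (EuclideanSpace.single i 1)).re

section NormPower

variable {E : Type*} [NormedAddCommGroup E] [NormedSpace ℝ E] [FiniteDimensional ℝ E]
  [MeasurableSpace E] [BorelSpace E]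

/-- The power `‖x‖ ^ s` is locally integrable as soon as `s > -dim E`. -/
lemma locallyIntegrable_norm_rpow (μ : Measure E) [μ.IsAddHaarMeasure]
    (hd : 1 ≤ Module.finrank ℝ E) {s : ℝ} (hs : -(Module.finrank ℝ E : ℝ) < s) :
    LocallyIntegrable (fun x : E => ‖x‖ ^ s) μ := by
  intro x
  refine ⟨Metric.ball 0 (‖x‖ + 1), Metric.isOpen_ball.mem_nhds (by simp), ?_⟩
  refine integrableOn_ball_of_norm_le_rpow (C := 1) (α := -s) hd (by linarith) ?_ ?_
  · refine Filter.Eventually.of_forall fun y => ?_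
    rw [neg_neg, one_mul, Real.norm_of_nonneg (by positivity)]
  · exact (measurable_norm.pow_const s).aestronglyMeasurable

/-- Euler's identity for the homogeneous weight `‖x‖ ^ s`, obtained by differentiating the
scaling law of `∫ ‖x‖ ^ s * g (t • x)` at `t = 1`. -/
lemma integral_norm_rpow_mul_fderiv_apply_self (μ : Measure E) [μ.IsAddHaarMeasure]
    (hd : 1 ≤ Module.finrank ℝ E) {s : ℝ} (hs : -(Module.finrank ℝ E : ℝ) < s)
    {g : E → ℝ} (hg : ContDiff ℝ 1 g) (hgs : HasCompactSupport g) :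
    ∫ x, ‖x‖ ^ s * fderiv ℝ g x x ∂μ =
      -((Module.finrank ℝ E : ℝ) + s) * ∫ x, ‖x‖ ^ s * g x ∂μ := by
  have hloc := locallyIntegrable_norm_rpow μ hd hs
  have hg' : Continuous (fderiv ℝ g) := hg.continuous_fderiv one_ne_zero
  obtain ⟨M, hM⟩ := (hgs.fderiv (𝕜 := ℝ)).exists_bound_of_continuous hg'
  obtain ⟨R, hR⟩ := (hgs.fderiv (𝕜 := ℝ)).isCompact.isBounded.subset_closedBall (0 : E)
  have hM0 : 0 ≤ M := (norm_nonneg _).trans (hM 0)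
  have hmeas : Measurable fun x : E => ‖x‖ ^ s := measurable_norm.pow_const s
  have key := hasDerivAt_integral_of_dominated_loc_of_deriv_le (μ := μ) (x₀ := (1 : ℝ))
    (s := Set.Ioi (1 / 2 : ℝ))
    (F := fun t x => ‖x‖ ^ s * g (t • x)) (F' := fun t x => ‖x‖ ^ s * fderiv ℝ g (t • x) x)
    (bound := (Metric.closedBall (0 : E) (2 * R)).indicator fun x => ‖x‖ ^ s * (M * (2 * R)))
    (Ioi_mem_nhds (by norm_num))
    (Filter.Eventually.of_forall fun t =>
      (hmeas.mul (hg.continuous.comp (continuous_const_smul t)).measurable).aestronglyMeasurable)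
    (by simpa using hloc.integrable_smul_right_of_hasCompactSupport hg.continuous hgs)
    (by
      refine (hmeas.mul (Continuous.measurable ?_)).aestronglyMeasurable
      fun_prop)
    (by
      refine Filter.Eventually.of_forall fun x t ht => ?_
      have ht' : (1 / 2 : ℝ) < t := ht
      by_cases hx : x ∈ Metric.closedBall (0 : E) (2 * R)
      · rw [Set.indicator_of_mem hx, norm_mul, Real.norm_of_nonneg (by positivity : 0 ≤ ‖x‖ ^ s)]
        gcongr
        refine ((fderiv ℝ g (t • x)).le_opNorm x).trans ?_
        gcongr
        · exact hM _
        · simpa using hx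
      · rw [Set.indicator_of_notMem hx]
        have hzero : fderiv ℝ g (t • x) = 0 := by
          refine image_eq_zero_of_notMem_tsupport fun hmem => hx ?_
          have := hR hmem
          simp only [mem_closedBall_zero_iff, norm_smul, Real.norm_eq_abs,
            abs_of_pos (show 0 < t by linarith)] at this ⊢
          nlinarith [norm_nonneg x]
        simp [hzero])
    (by
      rw [integrable_indicator_iff measurableSet_closedBall]
      exact (hloc.integrableOn_isCompact (isCompact_closedBall 0 (2 * R))).mul_const _)
    (by
      refine Filter.Eventually.of_forall fun x t _ => ?_
      have h1 : HasDerivAt (fun t : ℝ => t • x) x t := by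
        simpa using (hasDerivAt_id t).smul_const x
      exact (((hg.differentiable one_ne_zero (t • x)).hasFDerivAt).comp_hasDerivAt t h1).const_mul _)
  have hscale : (fun t : ℝ => ∫ x, ‖x‖ ^ s * g (t • x) ∂μ) =ᶠ[nhds 1]
      fun t => t ^ (-((Module.finrank ℝ E : ℝ) + s)) * ∫ x, ‖x‖ ^ s * g x ∂μ := by
    filter_upwards [Ioi_mem_nhds (zero_lt_one' ℝ)] with t ht
    have ht : 0 < t := ht
    have h1 : ∀ x : E, ‖x‖ ^ s * g (t • x) = t ^ (-s) * (‖t • x‖ ^ s * g (t • x)) := by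
      intro x
      rw [norm_smul, Real.norm_of_nonneg ht.le, Real.mul_rpow ht.le (norm_nonneg x),
        Real.rpow_neg ht.le]
      field_simp
    simp_rw [h1]
    rw [integral_const_mul,
      Measure.integral_comp_smul_of_nonneg μ (fun x => ‖x‖ ^ s * g x) t (hR := ht.le),
      smul_eq_mul, ← mul_assoc, neg_add_rev, Real.rpow_add ht, Real.rpow_neg ht.le (_ : ℕ),
      Real.rpow_natCast]
  have hpow : HasDerivAt
      (fun t : ℝ => t ^ (-((Module.finrank ℝ E : ℝ) + s)) * ∫ x, ‖x‖ ^ s * g x ∂μ)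
      (-((Module.finrank ℝ E : ℝ) + s) * ∫ x, ‖x‖ ^ s * g x ∂μ) 1 := by
    simpa using (Real.hasDerivAt_rpow_const (x := 1)
      (p := -((Module.finrank ℝ E : ℝ) + s)) (Or.inl one_ne_zero)).mul_const _
  simpa using (key.2.congr_of_eventuallyEq hscale.symm).unique hpow

end NormPower

/-- A compactly supported solution of the radial equation `x · ∇ψ + b ψ = 0` vanishes. -/
lemma eq_zero_of_fderiv_apply_self_add_smul_eq_zero {E F : Type*} [NormedAddCommGroup E]
    [NormedSpace ℝ E] [Nontrivial E] [NormedAddCommGroup F] [NormedSpace ℝ F] {ψ : E → F} {b : ℝ}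
    (hψ : Differentiable ℝ ψ) (hsupp : HasCompactSupport ψ)
    (h : ∀ x, fderiv ℝ ψ x x + b • ψ x = 0) : ψ = 0 := by
  have hne : ∀ x, x ≠ 0 → ψ x = 0 := by
    intro x hx
    have hderiv : ∀ t ∈ Set.Ioi (0 : ℝ), HasDerivAt (fun t : ℝ => t ^ b • ψ (t • x)) 0 t := by
      intro t ht
      have ht : 0 < t := ht
      have h1 : HasDerivAt (fun t : ℝ => t • x) x t := by
        simpa using (hasDerivAt_id t).smul_const x
      have h2 := (Real.hasDerivAt_rpow_const (x := t) (p := b) (Or.inl ht.ne')).smul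
        ((hψ (t • x)).hasFDerivAt.comp_hasDerivAt t h1)
      convert! h2 using 1
      have h3 : t ^ b = t ^ (b - 1) * t := by
        rw [← Real.rpow_add_one ht.ne', sub_add_cancel]
      have h4 := congrArg (fun v => t ^ (b - 1) • v) (h (t • x))
      simp only [smul_zero, map_smul, smul_add, smul_smul] at h4
      rw [h3, mul_comm b]
      exact h4.symm
    obtain ⟨R, hR⟩ := hsupp.isCompact.isBounded.subset_closedBall (0 : E)
    have hx' : 0 < ‖x‖ := norm_pos_iff.2 hx
    set T : ℝ := (|R| + 1) / ‖x‖
    have hT : 0 < T := by positivity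
    have hconst := isOpen_Ioi.is_const_of_deriv_eq_zero (convex_Ioi (0 : ℝ)).isPreconnected
      (fun t ht => (hderiv t ht).differentiableAt.differentiableWithinAt)
      (fun t ht => (hderiv t ht).deriv) (Set.mem_Ioi.2 one_pos) (Set.mem_Ioi.2 hT)
    have hzero : ψ (T • x) = 0 := by
      refine image_eq_zero_of_notMem_tsupport fun hmem => ?_
      have := hR hmem
      rw [mem_closedBall_zero_iff, norm_smul, Real.norm_of_nonneg hT.le,
        div_mul_cancel₀ _ hx'.ne'] at this
      linarith [le_abs_self R]
    simpa [hzero] using hconst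
  exact Continuous.ext_on (dense_compl_singleton (0 : E)) hψ.continuous continuous_const hne

lemma hasFDerivAt_norm_rpow_of_ne_zero {E : Type*} [NormedAddCommGroup E] [InnerProductSpace ℝ E]
    {x : E} (hx : x ≠ 0) (p : ℝ) :
    HasFDerivAt (fun x : E => ‖x‖ ^ p) ((p * ‖x‖ ^ (p - 2)) • innerSL ℝ x) x := by
  convert! (hasStrictFDerivAt_norm_sq x).hasFDerivAt.rpow_const (p := p / 2)
    (Or.inl (by simp [hx])) using 0
  simp_rw [← Real.rpow_natCast_mul (norm_nonneg _), ← Nat.cast_smul_eq_nsmul ℝ, smul_smul]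
  ring_nf

section Euclidean

variable {n : ℕ}

lemma map_eq_sum_coord_smul {F : Type*} [AddCommGroup F] [Module ℝ F] [TopologicalSpace F]
    (L : EuclideanSpace ℝ (Fin n) →L[ℝ] F) (x : EuclideanSpace ℝ (Fin n)) :
    L x = ∑ i, x i • L (EuclideanSpace.single i 1) := by
  conv_lhs => rw [← (EuclideanSpace.basisFun (Fin n) ℝ).sum_repr x]
  simp

lemma norm_sq_map_le (L : EuclideanSpace ℝ (Fin n) →L[ℝ] ℂ) (x : EuclideanSpace ℝ (Fin n)) :
    ‖L x‖ ^ 2 ≤ ‖x‖ ^ 2 * ∑ i, ‖L (EuclideanSpace.single i 1)‖ ^ 2 := by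
  rw [map_eq_sum_coord_smul L x, EuclideanSpace.norm_sq_eq]
  refine le_trans ?_ (Finset.sum_mul_sq_le_sq_mul_sq _ _ _)
  gcongr
  refine (norm_sum_le _ _).trans_eq ?_
  simp

/-- The pointwise value of `conj(∇ψ) · ∇(|x|^b ψ)` away from the origin. -/
lemma sum_conj_fderiv_mul_fderiv_norm_rpow_smul {b : ℝ} {ψ : EuclideanSpace ℝ (Fin n) → ℂ}
    {x : EuclideanSpace ℝ (Fin n)} (hψ : DifferentiableAt ℝ ψ x) (hx : x ≠ 0) :
    ∑ i : Fin n, (starRingEnd ℂ) (fderiv ℝ ψ x (EuclideanSpace.single i 1)) *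
        fderiv ℝ (fun x => (‖x‖ ^ b : ℝ) • ψ x) x (EuclideanSpace.single i 1) =
      (‖x‖ ^ (b - 2) : ℝ) • (((‖x‖ ^ 2 * ∑ i, ‖fderiv ℝ ψ x (EuclideanSpace.single i 1)‖ ^ 2 : ℝ) : ℂ)
        + b * ((starRingEnd ℂ) (fderiv ℝ ψ x x) * ψ x)) := by
  have hpow : ‖x‖ ^ b = ‖x‖ ^ (b - 2) * ‖x‖ ^ 2 := by
    rw [← Real.rpow_natCast, ← Real.rpow_add (norm_pos_iff.2 hx)]
    simp
  have hderiv : fderiv ℝ (fun x => (‖x‖ ^ b : ℝ) • ψ x) x = _ :=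
    ((hasFDerivAt_norm_rpow_of_ne_zero hx b).smul hψ.hasFDerivAt).fderiv
  rw [hderiv, map_eq_sum_coord_smul (fderiv ℝ ψ x) x]
  simp only [add_apply, smul_apply,
    ContinuousLinearMap.smulRight_apply, innerSL_apply_apply, EuclideanSpace.inner_single_right,
    hpow, map_sum, Complex.real_smul, map_mul, Complex.conj_ofReal]
  push_cast
  simp only [mul_add, Finset.sum_add_distrib, Finset.mul_sum, Finset.sum_mul, ← Complex.conj_mul']
  congr 1 <;> refine Finset.sum_congr rfl fun i _ => ?_
  · ring
  · simp
    ring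

end Euclidean

/-- Positivity of `½(|p|²|q|^b + |q|^b|p|²)` on `C₀^∞(ℝⁿ)` for `n ≥ 3`
and `0 < b ≤ n - 2`:
`Re ∫ conj(∇ψ(x)) · ∇(|x|^b ψ(x)) dx > 0` for nonzero `ψ`. -/
theorem gradForm_pos
    (n : ℕ) (hn : 3 ≤ n) (b : ℝ) (hb : 0 < b) (hbn : b ≤ (n : ℝ) - 2)
    (ψ : EuclideanSpace ℝ (Fin n) → ℂ)
    (hsmooth : ContDiff ℝ (⊤ : ℕ∞) ψ) (hsupp : HasCompactSupport ψ) (hne : ψ ≠ 0) :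
    0 < gradForm n ψ (fun x => (‖x‖ ^ b : ℝ) • ψ x) := by
  have hnR : (3 : ℝ) ≤ n := by exact_mod_cast hn
  have hdim : Module.finrank ℝ (EuclideanSpace ℝ (Fin n)) = n := by simp
  have hd : 1 ≤ Module.finrank ℝ (EuclideanSpace ℝ (Fin n)) := by omega
  have : Nontrivial (EuclideanSpace ℝ (Fin n)) := Module.nontrivial_of_finrank_pos (R := ℝ) hd
  have hs : -(Module.finrank ℝ (EuclideanSpace ℝ (Fin n)) : ℝ) < b - 2 := by
    rw [hdim]; linarith
  have hdiff : Differentiable ℝ ψ := hsmooth.differentiable (by simp)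
  have hψ : Continuous ψ := hsmooth.continuous
  have hψ' : Continuous (fderiv ℝ ψ) := hsmooth.continuous_fderiv (by simp)
  have hloc := locallyIntegrable_norm_rpow (volume : Measure (EuclideanSpace ℝ (Fin n))) hd hs
  -- Every function below is controlled by `ψ` and its derivative, hence vanishes off its support.
  have hcs : ∀ {F : Type} [NormedAddCommGroup F] {f : EuclideanSpace ℝ (Fin n) → F},
      (∀ x, ψ x = 0 → fderiv ℝ ψ x = 0 → f x = 0) → HasCompactSupport f := by
    intro F _ f hf
    refine hsupp.of_isClosed_subset (isClosed_tsupport f) (closure_minimal ?_ (isClosed_tsupport ψ))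
    intro x hx
    by_contra hx'
    refine hx (hf x (image_eq_zero_of_notMem_tsupport hx') ?_)
    exact image_eq_zero_of_notMem_tsupport fun h => hx' (tsupport_fderiv_subset ℝ h)
  set R : EuclideanSpace ℝ (Fin n) → ℂ := fun x => fderiv ℝ ψ x x
  have hR : Continuous R := hψ'.clm_apply continuous_id
  set g : EuclideanSpace ℝ (Fin n) → ℝ := fun x => ‖ψ x‖ ^ 2
  have hg : ContDiff ℝ 1 g := (hsmooth.of_le (by simp)).norm_sq ℝ
  have hgs : HasCompactSupport g := hcs fun x h _ => by simp [g, h]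
  have hg' : ∀ x, fderiv ℝ g x x = 2 * inner ℝ (ψ x) (R x) := by
    intro x
    rw [((hdiff x).hasFDerivAt.norm_sq).fderiv]
    simp [R, mul_add]
  set H : EuclideanSpace ℝ (Fin n) → ℂ := fun x =>
    ((‖x‖ ^ 2 * ∑ i, ‖fderiv ℝ ψ x (EuclideanSpace.single i 1)‖ ^ 2 : ℝ) : ℂ)
      + b * ((starRingEnd ℂ) (R x) * ψ x)
  set T : EuclideanSpace ℝ (Fin n) → ℝ := fun x => ‖R x + b • ψ x‖ ^ 2
  have hHc : Continuous H := by
    have := Complex.continuous_conj.comp hR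
    have h2 : ∀ i : Fin n, Continuous fun x => fderiv ℝ ψ x (EuclideanSpace.single i 1) :=
      fun i => hψ'.clm_apply continuous_const
    refine (Complex.continuous_ofReal.comp ?_).add (continuous_const.mul (this.mul hψ))
    fun_prop
  have hTc : Continuous T := by fun_prop
  have hH := hloc.integrable_smul_right_of_hasCompactSupport hHc
    (hcs fun x h h' => by simp [H, R, h, h'])
  have hT := hloc.integrable_smul_right_of_hasCompactSupport hTc
    (hcs fun x h h' => by simp [T, R, h, h'])
  have hgi := hloc.integrable_smul_right_of_hasCompactSupport hg.continuous hgs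
  have hg'i := hloc.integrable_smul_right_of_hasCompactSupport
    (g := fun x => fderiv ℝ g x x)
    ((hg.continuous_fderiv one_ne_zero).clm_apply continuous_id)
    (hcs fun x h h' => by simp [hg', h])
  simp only [smul_eq_mul] at hT hgi hg'i
  have hform : gradForm n ψ (fun x => (‖x‖ ^ b : ℝ) • ψ x) =
      ∫ x, ‖x‖ ^ (b - 2) * (H x).re := by
    have hae : ∀ᵐ x : EuclideanSpace ℝ (Fin n), x ≠ 0 := by
      simp [ae_iff]
    rw [gradForm, integral_congr_ae (g := fun x => (‖x‖ ^ (b - 2) : ℝ) • H x)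
      (hae.mono fun x hx => sum_conj_fderiv_mul_fderiv_norm_rpow_smul (hdiff x) hx)]
    refine (integral_re hH).symm.trans ?_
    simp
  have hle : ∀ x, T x - b / 2 * fderiv ℝ g x x - b ^ 2 * g x ≤ (H x).re := by
    intro x
    have h1 := norm_sq_map_le (fderiv ℝ ψ x) x
    have h2 : (H x).re = ‖x‖ ^ 2 * ∑ i, ‖fderiv ℝ ψ x (EuclideanSpace.single i 1)‖ ^ 2
        + b * inner ℝ (ψ x) (R x) := by
      simp only [H, Complex.add_re, Complex.ofReal_re, Complex.re_ofReal_mul, Complex.inner]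
      simp
    have h3 : T x = ‖R x‖ ^ 2 + 2 * b * inner ℝ (ψ x) (R x) + b ^ 2 * g x := by
      simp only [T, g]
      rw [norm_add_sq_real, inner_smul_right, real_inner_comm, norm_smul, mul_pow,
        Real.norm_eq_abs, sq_abs]
      ring
    rw [h2, h3, hg']
    simp only [R] at h1 ⊢
    linarith
  have hTpos : 0 < ∫ x, ‖x‖ ^ (b - 2) * T x := by
    rw [integral_pos_iff_support_of_nonneg (fun x => by positivity) hT]
    obtain ⟨y, hy⟩ : ∃ y, T y ≠ 0 := by
      by_contra! h
      exact hne (eq_zero_of_fderiv_apply_self_add_smul_eq_zero (b := b) hdiff hsupp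
        fun x => by simpa [T] using h x)
    have hopen : IsOpen (Function.support T) := hTc.isOpen_support
    have hpos := hopen.measure_pos volume ⟨y, hy⟩
    rw [← measure_sdiff_null (measure_singleton (0 : EuclideanSpace ℝ (Fin n)))] at hpos
    refine hpos.trans_le (measure_mono fun x hx => ?_)
    have hx0 : 0 < ‖x‖ := norm_pos_iff.2 hx.2
    exact mul_ne_zero (Real.rpow_pos_of_pos hx0 _).ne' hx.1
  have heuler := integral_norm_rpow_mul_fderiv_apply_self
    (volume : Measure (EuclideanSpace ℝ (Fin n))) hd hs hg hgs
  rw [hdim] at heuler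
  have hg0 : 0 ≤ ∫ x, ‖x‖ ^ (b - 2) * g x := integral_nonneg fun x => by positivity
  have hTg : Integrable fun x => ‖x‖ ^ (b - 2) * T x
      - b / 2 * (‖x‖ ^ (b - 2) * fderiv ℝ g x x) := hT.sub (hg'i.const_mul _)
  calc 0 < (∫ x, ‖x‖ ^ (b - 2) * T x)
          + b / 2 * (n - 2 - b) * ∫ x, ‖x‖ ^ (b - 2) * g x := by
        have : 0 ≤ (n : ℝ) - 2 - b := by linarith
        positivity
    _ = (∫ x, ‖x‖ ^ (b - 2) * T x) - b / 2 * (∫ x, ‖x‖ ^ (b - 2) * fderiv ℝ g x x)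
          - b ^ 2 * ∫ x, ‖x‖ ^ (b - 2) * g x := by
        rw [heuler]; ring
    _ = ∫ x, (‖x‖ ^ (b - 2) * T x - b / 2 * (‖x‖ ^ (b - 2) * fderiv ℝ g x x)
          - b ^ 2 * (‖x‖ ^ (b - 2) * g x)) := by
        rw [integral_sub hTg (hgi.const_mul _),
          integral_sub hT (hg'i.const_mul _), integral_const_mul, integral_const_mul]
    _ ≤ ∫ x, ‖x‖ ^ (b - 2) * (H x).re := by
        refine integral_mono (hTg.sub (hgi.const_mul _))
          (by simpa using hH.re) fun x => ?_
        have := mul_le_mul_of_nonneg_left (hle x) (Real.rpow_nonneg (norm_nonneg x) (b - 2))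
        simp only
        linarith
    _ = _ := hform.symm
end

section
/- Let n be a positive integer, a ∈ (0,2), b > 0 with a + b < n, γ := (n+b−a)/2, α_{a,n} := 2^{a−1} π^{−n/2} Γ((n+a)/2)/|Γ(−a/2)|, and L_{a,b,n} := 2^a Γ((n−b+a)/4) Γ((n+b+a)/4) / (Γ((n+b−a)/4) Γ((n−b−a)/4)). Then for every smooth ψ : ℝⁿ → ℂ compactly supported in ℝⁿ \ {0}: (α_{a,n}/2) ∫_{ℝⁿ}∫_{ℝⁿ} [ 2|ψ(x)|²|x|^b + 2|ψ(y)|²|y|^b − |ψ(x)|²|x|^γ|y|^{b−γ} − |ψ(y)|²|x|^{b−γ}|y|^γ − |ψ(x)|²|x|^{b+γ}|y|^{−γ} − |ψ(y)|²|x|^{−γ}|y|^{b+γ} ] / |x−y|^{n+a} dx dy = L_{a,b,n} ∫_{ℝⁿ} |ψ(x)|² |x|^{b−a} dx. -/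
open MeasureTheory Real

theorem integrableOn_rpow_sub_one_mul_exp {q r : ℝ} (hq : 0 < q) (hr : 0 < r) :
    IntegrableOn (fun t : ℝ => t ^ (q - 1) * exp (-(r * t))) (Set.Ioi 0) := by
  have := integrableOn_rpow_mul_exp_neg_mul_rpow (s := q - 1) (p := 1) (b := r)
    (by linarith) one_pos hr
  simpa [Real.rpow_one, neg_mul] using this

theorem integrableOn_beta {u v : ℝ} (hu : 0 < u) (hv : 0 < v) :
    IntegrableOn (fun w : ℝ => w ^ (u - 1) * (1 - w) ^ (v - 1)) (Set.Ioo 0 1) := by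
  have h := Complex.betaIntegral_convergent (u := u) (v := v) (by simpa) (by simpa)
  rw [intervalIntegrable_iff_integrableOn_Ioo_of_le zero_le_one] at h
  refine IntegrableOn.congr_fun (Integrable.re h) (fun w hw => ?_) measurableSet_Ioo
  have h1 : ((w : ℂ) ^ ((u : ℂ) - 1)) = ((w ^ (u - 1) : ℝ) : ℂ) := by
    rw [Complex.ofReal_cpow hw.1.le]; push_cast; rfl
  have h2 : ((1 - (w : ℂ)) ^ ((v : ℂ) - 1)) = (((1 - w) ^ (v - 1) : ℝ) : ℂ) := by
    rw [Complex.ofReal_cpow (by linarith [hw.2])]; push_cast; rfl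
  simp only [h1, h2]
  rw [← Complex.ofReal_mul]
  simp

theorem integral_beta {u v : ℝ} (hu : 0 < u) (hv : 0 < v) :
    ∫ w in Set.Ioo (0 : ℝ) 1, w ^ (u - 1) * (1 - w) ^ (v - 1) =
      Gamma u * Gamma v / Gamma (u + v) := by
  have h := Complex.betaIntegral_eq_Gamma_mul_div u v (by simpa) (by simpa)
  rw [← Complex.ofReal_inj]
  have e : ((Gamma u * Gamma v / Gamma (u + v) : ℝ) : ℂ) = Complex.betaIntegral u v := by
    rw [h]; push_cast [← Complex.Gamma_ofReal]; rfl
  rw [e, Complex.betaIntegral, intervalIntegral.integral_of_le zero_le_one,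
    integral_Ioc_eq_integral_Ioo, ← integral_complex_ofReal]
  refine setIntegral_congr_fun measurableSet_Ioo (fun w hw => ?_)
  have h1 : ((w : ℂ) ^ ((u : ℂ) - 1)) = ((w ^ (u - 1) : ℝ) : ℂ) := by
    rw [Complex.ofReal_cpow hw.1.le]; push_cast; rfl
  have h2 : ((1 - (w : ℂ)) ^ ((v : ℂ) - 1)) = (((1 - w) ^ (v - 1) : ℝ) : ℂ) := by
    rw [Complex.ofReal_cpow (by linarith [hw.2])]; push_cast; rfl
  simp only [h1, h2]
  push_cast; rfl

/-- For `β > 0` the increment `1 - (1 - w) ^ β` is at most linear on `[0, 1]`. -/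
theorem one_sub_one_sub_rpow_le {β w : ℝ} (hβ : 0 < β) (h0 : 0 ≤ w) (h1 : w ≤ 1) :
    1 - (1 - w) ^ β ≤ max 1 β * w := by
  rcases le_total β 1 with h | h
  · have : (1 - w) ^ (1 : ℝ) ≤ (1 - w) ^ β := by
      rcases eq_or_lt_of_le h1 with rfl | h1
      · simp [hβ.ne']
      · exact Real.rpow_le_rpow_of_exponent_ge (by linarith) (by linarith) h
    rw [Real.rpow_one] at this
    rw [max_eq_left h]; linarith
  · have := one_add_mul_self_le_rpow_one_add (s := -w) (by linarith) h
    rw [max_eq_right h, sub_eq_add_neg 1 w]; linarith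

theorem integral_one_sub_one_sub_rpow {p β : ℝ} (hp0 : 0 < p) (hp1 : p < 1) (hβ : p < β) :
    IntegrableOn (fun w : ℝ => w ^ (-p - 1) * (1 - (1 - w) ^ (β - 1))) (Set.Ioo 0 1) ∧
    ∫ w in Set.Ioo (0 : ℝ) 1, w ^ (-p - 1) * (1 - (1 - w) ^ (β - 1)) =
      -1 / p + (β - p) / p * (Gamma (1 - p) * Gamma β / Gamma (1 - p + β)) := by
  have hβ0 : 0 < β := hp0.trans hβ
  have hbeta := integrableOn_beta (u := 1 - p) (v := β) (by linarith) hβ0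
  have hbetaI := integral_beta (u := 1 - p) (v := β) (by linarith) hβ0
  simp only [sub_sub_cancel_left] at hbeta hbetaI
  set G : ℝ → ℝ := fun w => w ^ (-p) * (1 - (1 - w) ^ β) with hG
  set G' : ℝ → ℝ := fun w => (-p) * (w ^ (-p - 1) * (1 - (1 - w) ^ β))
    + β * (w ^ (-p) * (1 - w) ^ (β - 1)) with hG'
  have hnn : ∀ w ∈ Set.Icc (0 : ℝ) 1, 0 ≤ 1 - (1 - w) ^ β := fun w hw => by
    have := Real.rpow_le_one (x := 1 - w) (by linarith [hw.2]) (by linarith [hw.1]) hβ0.le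
    linarith
  have hA : IntegrableOn (fun w : ℝ => w ^ (-p - 1) * (1 - (1 - w) ^ β)) (Set.Ioo 0 1) := by
    have hb : IntegrableOn (fun w : ℝ => max 1 β * w ^ (-p)) (Set.Ioo 0 1) := by
      refine Integrable.const_mul ?_ _
      exact (intervalIntegral.integrableOn_Ioo_rpow_iff zero_lt_one).2 (by linarith)
    refine Integrable.mono' hb ?_ ?_
    · exact Measurable.aestronglyMeasurable (by fun_prop)
    · refine (ae_restrict_iff' measurableSet_Ioo).2 (.of_forall fun w hw => ?_)
      have hw' : w ∈ Set.Icc (0 : ℝ) 1 := ⟨hw.1.le, hw.2.le⟩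
      have hpos := Real.rpow_nonneg hw.1.le (-p - 1)
      rw [Real.norm_of_nonneg (mul_nonneg hpos (hnn w hw'))]
      have e : w ^ (-p) = w ^ (-p - 1) * w := by
        rw [← Real.rpow_add_one hw.1.ne']; ring_nf
      rw [e]
      have := one_sub_one_sub_rpow_le hβ0 hw.1.le hw.2.le
      nlinarith [mul_le_mul_of_nonneg_left this hpos]
  have hG'int : IntegrableOn G' (Set.Ioo 0 1) :=
    (hA.const_mul _).add (hbeta.const_mul _)
  have hcont : ContinuousOn G (Set.Icc 0 1) := by
    intro w hw
    rcases eq_or_lt_of_le hw.1 with rfl | hw0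
    · have hG0 : G 0 = 0 := by simp [hG]
      rw [ContinuousWithinAt, hG0]
      have hlim : Filter.Tendsto (fun w : ℝ => max 1 β * w ^ (1 - p))
          (nhdsWithin 0 (Set.Icc 0 1)) (nhds 0) := by
        have : ContinuousAt (fun w : ℝ => max 1 β * w ^ (1 - p)) 0 :=
          continuousAt_const.mul (Real.continuousAt_rpow_const _ _ (Or.inr (by linarith)))
        have h := this.tendsto
        simp only [Real.zero_rpow (by linarith : (1 - p) ≠ 0), mul_zero] at h
        exact h.mono_left nhdsWithin_le_nhds
      refine tendsto_of_tendsto_of_tendsto_of_le_of_le' tendsto_const_nhds hlim ?_ ?_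
      · filter_upwards [self_mem_nhdsWithin] with w hw
        exact mul_nonneg (Real.rpow_nonneg hw.1 _) (hnn w hw)
      · filter_upwards [self_mem_nhdsWithin] with w hw
        rcases eq_or_lt_of_le hw.1 with rfl | hw0
        · rw [hG0]; positivity
        have e : w ^ (1 - p) = w ^ (-p) * w := by
          rw [← Real.rpow_add_one hw0.ne']; ring_nf
        have := one_sub_one_sub_rpow_le hβ0 hw.1 hw.2
        simp only [hG, e]
        nlinarith [mul_le_mul_of_nonneg_left this (Real.rpow_nonneg hw.1 (-p))]
    · apply ContinuousAt.continuousWithinAt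
      refine (Real.continuousAt_rpow_const _ _ (Or.inl hw0.ne')).mul (continuousAt_const.sub ?_)
      exact ContinuousAt.rpow_const (by fun_prop) (Or.inr hβ0.le)
  have hder : ∀ w ∈ Set.Ioo (0 : ℝ) 1, HasDerivAt G (G' w) w := by
    intro w hw
    have h1 := Real.hasDerivAt_rpow_const (x := w) (p := -p) (Or.inl hw.1.ne')
    have h2 : HasDerivAt (fun w : ℝ => (1 - w) ^ β) (-1 * β * (1 - w) ^ (β - 1)) w :=
      ((hasDerivAt_id w).const_sub 1).rpow_const (Or.inl (by simp; linarith [hw.2]))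
    refine (h1.mul (h2.const_sub 1)).congr_deriv ?_
    simp only [hG']; ring
  have hFTC : ∫ w in Set.Ioo (0 : ℝ) 1, G' w = 1 := by
    have := intervalIntegral.integral_eq_sub_of_hasDerivAt_of_le zero_le_one hcont hder
      ((intervalIntegrable_iff_integrableOn_Ioo_of_le zero_le_one).2 hG'int)
    rw [intervalIntegral.integral_of_le zero_le_one, integral_Ioc_eq_integral_Ioo] at this
    rw [this]; simp [hG, hβ0.ne']
  have hkey : Set.EqOn
      (fun w : ℝ => (-1 / p) * G' w + ((β - p) / p) * (w ^ (-p) * (1 - w) ^ (β - 1)))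
      (fun w : ℝ => w ^ (-p - 1) * (1 - (1 - w) ^ (β - 1))) (Set.Ioo 0 1) := by
    intro w hw
    have e : w ^ (-p) = w ^ (-p - 1) * w := by
      rw [← Real.rpow_add_one hw.1.ne']; ring_nf
    have e2 : (1 - w) ^ β = (1 - w) ^ (β - 1) * (1 - w) := by
      rw [← Real.rpow_add_one (by linarith [hw.2])]; ring_nf
    simp only [hG', e, e2]
    field_simp
    ring
  refine ⟨IntegrableOn.congr_fun ((hG'int.const_mul _).add (hbeta.const_mul _)) hkey
    measurableSet_Ioo, ?_⟩
  rw [← setIntegral_congr_fun measurableSet_Ioo hkey,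
    integral_add (hG'int.const_mul _) (hbeta.const_mul _), integral_const_mul, integral_const_mul,
    hFTC, hbetaI]
  ring

/-- The defect `1 - (1 - w)₊ ^ (β - 1)`. -/
noncomputable def powDefect (β w : ℝ) : ℝ :=
  1 - if w < 1 then (1 - w) ^ (β - 1) else 0

@[fun_prop]
theorem measurable_powDefect (β : ℝ) : Measurable (powDefect β) := by
  unfold powDefect
  exact measurable_const.sub (Measurable.ite measurableSet_Iio (by fun_prop) measurable_const)

theorem integral_powDefect {p β : ℝ} (hp0 : 0 < p) (hp1 : p < 1) (hβ : p < β) :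
    IntegrableOn (fun w : ℝ => w ^ (-p - 1) * powDefect β w) (Set.Ioi 0) ∧
    ∫ w in Set.Ioi (0 : ℝ), w ^ (-p - 1) * powDefect β w =
      Gamma (1 - p) / p * Gamma β / Gamma (β - p) := by
  obtain ⟨hi, hI⟩ := integral_one_sub_one_sub_rpow hp0 hp1 hβ
  have c1 : Set.EqOn (fun w : ℝ => w ^ (-p - 1) * (1 - (1 - w) ^ (β - 1)))
      (fun w : ℝ => w ^ (-p - 1) * powDefect β w) (Set.Ioo 0 1) := fun w hw => by
    simp [powDefect, hw.2]
  have c2 : Set.EqOn (fun w : ℝ => w ^ (-p - 1))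
      (fun w : ℝ => w ^ (-p - 1) * powDefect β w) (Set.Ici 1) := fun w hw => by
    have : ¬ w < 1 := not_lt.2 hw
    simp [powDefect, this]
  have h2i : IntegrableOn (fun w : ℝ => w ^ (-p - 1)) (Set.Ici 1) := by
    rw [integrableOn_Ici_iff_integrableOn_Ioi]
    exact integrableOn_Ioi_rpow_of_lt (by linarith) zero_lt_one
  have i1 := hi.congr_fun c1 measurableSet_Ioo
  have i2 := h2i.congr_fun c2 measurableSet_Ici
  have hu : Set.Ioi (0 : ℝ) = Set.Ioo 0 1 ∪ Set.Ici 1 :=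
    (Set.Ioo_union_Ici_eq_Ioi zero_lt_one).symm
  rw [hu]
  refine ⟨i1.union i2, ?_⟩
  rw [setIntegral_union _ measurableSet_Ici i1 i2,
    ← setIntegral_congr_fun measurableSet_Ioo c1, ← setIntegral_congr_fun measurableSet_Ici c2, hI,
    integral_Ici_eq_integral_Ioi, integral_Ioi_rpow_of_lt (by linarith) zero_lt_one]
  · have hg : Gamma (1 - p + β) = (β - p) * Gamma (β - p) := by
      rw [← Real.Gamma_add_one (by linarith)]; ring_nf
    have hgp : Gamma (β - p) ≠ 0 := (Real.Gamma_pos_of_pos (by linarith)).ne'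
    have : β - p ≠ 0 := by linarith
    rw [hg, Real.one_rpow, sub_add_cancel]
    field_simp
    ring
  · exact Set.disjoint_left.2 fun w hw hw' => absurd hw.2 (not_lt.2 hw')

theorem image_mul_div_one_sub {t : ℝ} (ht : 0 < t) :
    (fun w : ℝ => t * w / (1 - w)) '' Set.Ioo 0 1 = Set.Ioi 0 := by
  ext u
  constructor
  · rintro ⟨w, hw, rfl⟩
    exact div_pos (mul_pos ht hw.1) (by linarith [hw.2])
  · intro hu
    have hu : 0 < u := hu
    refine ⟨u / (t + u), ⟨by positivity, by rw [div_lt_one (by positivity)]; linarith⟩, ?_⟩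
    simp only
    have : (1 : ℝ) - u / (t + u) = t / (t + u) := by field_simp; ring
    rw [this]; field_simp

theorem injOn_mul_div_one_sub {t : ℝ} (ht : 0 < t) :
    Set.InjOn (fun w : ℝ => t * w / (1 - w)) (Set.Ioo 0 1) := by
  intro w hw v hv h
  have h1 : 1 - w ≠ 0 := by linarith [hw.2]
  have h2 : 1 - v ≠ 0 := by linarith [hv.2]
  simp only [div_eq_div_iff h1 h2] at h
  have : t * (w - v) = 0 := by linarith
  rcases mul_eq_zero.1 this with h | h <;> linarith

theorem integral_rpow_mul_exp_mul_norm_sq {E : Type*} [NormedAddCommGroup E] {s w : ℝ}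
    (hs : 0 < s) (hw : 0 < w) {x : E}
    (hx : x ≠ 0) :
    ∫ t in Set.Ioi (0 : ℝ), t ^ (s / 2 - 1) * exp (-(w * ‖x‖ ^ 2 * t)) =
      w ^ (-(s / 2)) * (‖x‖ ^ (-s) * Gamma (s / 2)) := by
  have hx' : 0 < ‖x‖ := norm_pos_iff.2 hx
  rw [Real.integral_rpow_mul_exp_neg_mul_Ioi (by linarith) (by positivity), one_div,
    Real.inv_rpow (by positivity), ← Real.rpow_neg (by positivity),
    Real.mul_rpow hw.le (by positivity), ← Real.rpow_natCast, ← Real.rpow_mul hx'.le, mul_assoc]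
  congr 4
  push_cast; ring

/-- The part of `‖y‖ ^ (-s)` carried by the unit ball. -/
noncomputable def rieszBall (E : Type*) [NormedAddCommGroup E] (s : ℝ) : E → ℝ :=
  (Metric.ball (0 : E) 1).indicator fun y => ‖y‖ ^ (-s)

theorem rieszBall_nonneg {E : Type*} [NormedAddCommGroup E] (s : ℝ) (y : E) : 0 ≤ rieszBall E s y :=
  Set.indicator_nonneg (fun _ _ => by positivity) y

theorem norm_rpow_neg_le {E : Type*} [NormedAddCommGroup E] {s : ℝ} (hs : 0 ≤ s) (y : E) :
    ‖y‖ ^ (-s) ≤ rieszBall E s y + 1 := by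
  by_cases hy : y ∈ Metric.ball (0 : E) 1
  · rw [rieszBall, Set.indicator_of_mem hy]; linarith
  · rw [rieszBall, Set.indicator_of_notMem hy, zero_add]
    exact Real.rpow_le_one_of_one_le_of_nonpos (by simpa using hy) (by linarith)

theorem abs_rpow_neg_sub_rpow_neg_le {s ρ u v : ℝ} (hs : 0 ≤ s) (hρ : 0 < ρ) (hu : ρ ≤ u)
    (hv : ρ ≤ v) : |u ^ (-s) - v ^ (-s)| ≤ s * ρ ^ (-s - 1) * |u - v| := by
  refine (convex_Ici ρ).norm_image_sub_le_of_norm_hasDerivWithin_le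
    (f := fun w : ℝ => w ^ (-s)) (f' := fun w => -s * w ^ (-s - 1)) (fun w hw => ?_)
    (fun w hw => ?_) hv hu
  · exact (Real.hasDerivAt_rpow_const (Or.inl (hρ.trans_le hw).ne')).hasDerivWithinAt
  · have hw : ρ ≤ w := hw
    have hw0 : 0 < w := hρ.trans_le hw
    rw [norm_mul, norm_neg, Real.norm_of_nonneg hs, Real.norm_of_nonneg (by positivity)]
    exact mul_le_mul_of_nonneg_left
      (Real.rpow_le_rpow_of_nonpos hρ hw (by linarith)) hs

section Euclidean

variable {E : Type*} [NormedAddCommGroup E] [InnerProductSpace ℝ E] [FiniteDimensional ℝ E]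
  [MeasurableSpace E] [BorelSpace E]

theorem integral_exp_neg_mul_norm_sub_sq {t : ℝ} (ht : 0 < t) (x : E) :
    ∫ y : E, exp (-(t * ‖x - y‖ ^ 2)) = (π / t) ^ ((Module.finrank ℝ E : ℝ) / 2) := by
  rw [← GaussianFourier.integral_rexp_neg_mul_sq_norm (V := E) ht,
    ← integral_sub_left_eq_self (fun y : E => exp (-t * ‖y‖ ^ 2)) volume x]
  simp only [neg_mul]

theorem integrable_exp_neg_mul_norm_sq {t : ℝ} (ht : 0 < t) :
    Integrable (fun y : E => exp (-(t * ‖y‖ ^ 2))) := by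
  refine Integrable.of_integral_ne_zero ?_
  have := integral_exp_neg_mul_norm_sub_sq (E := E) ht 0
  simp only [zero_sub, norm_neg] at this
  rw [this]
  positivity

theorem integrable_exp_neg_mul_norm_sub_sq {t : ℝ} (ht : 0 < t) (x : E) :
    Integrable (fun y : E => exp (-(t * ‖x - y‖ ^ 2))) :=
  (integrable_exp_neg_mul_norm_sq ht).comp_sub_left x

theorem integral_exp_mul_exp_neg_norm_sq {t u : ℝ} (ht : 0 < t) (hu : 0 < u) (x : E) :
    ∫ y : E, exp (-(u * ‖y‖ ^ 2)) * exp (-(t * ‖x - y‖ ^ 2)) =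
      (π / (t + u)) ^ ((Module.finrank ℝ E : ℝ) / 2) * exp (-(t * u / (t + u) * ‖x‖ ^ 2)) := by
  have htu : 0 < t + u := add_pos ht hu
  rw [← integral_exp_neg_mul_norm_sub_sq htu ((t / (t + u)) • x), ← integral_mul_const]
  congr 1 with y
  rw [← Real.exp_add, ← Real.exp_add]
  congr 1
  rw [norm_sub_sq_real, norm_sub_sq_real, norm_smul, real_inner_smul_left, mul_pow,
    Real.norm_eq_abs, sq_abs]
  field_simp
  ring

theorem integrable_mul_comp_sub {f g : E → ℝ} (hf : Integrable f) (hg : Integrable g) :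
    Integrable (fun z : E × E => f z.1 * g (z.1 - z.2)) := by
  have h := (hf.convolution_integrand (ContinuousLinearMap.mul ℝ ℝ)
    (hg.comp_neg)).swap
  refine h.congr (.of_forall fun z => ?_)
  simp [Function.comp]

theorem integrable_rieszBall [Nontrivial E] {s : ℝ} (hs : s < Module.finrank ℝ E) :
    Integrable (rieszBall E s) := by
  refine (integrable_indicator_iff Metric.isOpen_ball.measurableSet).2 ?_
  refine integrableOn_ball_of_norm_le_rpow (C := 1) (α := s) ?_ hs ?_ ?_
  · exact Module.finrank_pos
  · refine .of_forall fun x => ?_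
    rw [Real.norm_of_nonneg (by positivity), one_mul]
  · exact Measurable.aestronglyMeasurable (by fun_prop)

theorem integrable_norm_rpow_mul_exp [Nontrivial E] {s t : ℝ} (hs0 : 0 ≤ s)
    (hs : s < Module.finrank ℝ E) (ht : 0 < t) (x : E) :
    Integrable (fun y : E => ‖y‖ ^ (-s) * exp (-(t * ‖x - y‖ ^ 2))) := by
  refine Integrable.mono' ((integrable_rieszBall hs).add (integrable_exp_neg_mul_norm_sub_sq ht x))
    (Measurable.aestronglyMeasurable (by fun_prop)) (.of_forall fun y => ?_)
  rw [Real.norm_of_nonneg (by positivity)]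
  have h1 := norm_rpow_neg_le hs0 y
  have h2 : exp (-(t * ‖x - y‖ ^ 2)) ≤ 1 := Real.exp_le_one_iff.2 (by
    have : 0 ≤ t * ‖x - y‖ ^ 2 := by positivity
    linarith)
  have h3 := (Real.exp_pos (-(t * ‖x - y‖ ^ 2))).le
  have h4 := rieszBall_nonneg s y
  simp only [Pi.add_apply]
  nlinarith [mul_le_mul_of_nonneg_right h1 h3]

theorem integrable_prod_norm_rpow_mul_exp [Nontrivial E] {s t : ℝ} (hs0 : 0 ≤ s)
    (hs : s < Module.finrank ℝ E) (ht : 0 < t) {f : E → ℝ} (hf : Integrable f) :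
    Integrable (fun z : E × E => f z.1 * ‖z.2‖ ^ (-s) * exp (-(t * ‖z.1 - z.2‖ ^ 2))) := by
  refine Integrable.mono' ((hf.norm.mul_prod (integrable_rieszBall (E := E) hs)).add
    (integrable_mul_comp_sub hf.norm (integrable_exp_neg_mul_norm_sq (E := E) ht))) ?_ ?_
  · refine (hf.aestronglyMeasurable.comp_fst.mul ?_).mul ?_ <;>
    exact Measurable.aestronglyMeasurable (by fun_prop)
  refine .of_forall fun z => ?_
  rw [norm_mul, norm_mul, Real.norm_of_nonneg (Real.exp_pos _).le,
    Real.norm_of_nonneg (show 0 ≤ ‖z.2‖ ^ (-s) by positivity)]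
  have h1 := norm_rpow_neg_le hs0 z.2
  have h2 : exp (-(t * ‖z.1 - z.2‖ ^ 2)) ≤ 1 := Real.exp_le_one_iff.2 (by
    have : 0 ≤ t * ‖z.1 - z.2‖ ^ 2 := by positivity
    linarith)
  have h3 := (Real.exp_pos (-(t * ‖z.1 - z.2‖ ^ 2))).le
  have h4 := rieszBall_nonneg s z.2
  have h5 : ‖z.2‖ ^ (-s) * exp (-(t * ‖z.1 - z.2‖ ^ 2)) ≤
      rieszBall E s z.2 + exp (-(t * ‖z.1 - z.2‖ ^ 2)) := by
    nlinarith [mul_le_mul_of_nonneg_right h1 h3]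
  simp only [Pi.add_apply]
  rw [mul_assoc, ← mul_add]
  exact mul_le_mul_of_nonneg_left h5 (norm_nonneg _)

/-- The Gauss transform of `‖y‖ ^ (-s)`. -/
theorem Gamma_mul_integral_norm_rpow_mul_exp [Nontrivial E] {s t : ℝ} (hs0 : 0 < s)
    (hs : s < Module.finrank ℝ E) (ht : 0 < t) (x : E) :
    Gamma (s / 2) * ∫ y : E, ‖y‖ ^ (-s) * exp (-(t * ‖x - y‖ ^ 2)) =
      (π / t) ^ ((Module.finrank ℝ E : ℝ) / 2) * t ^ (s / 2) *
        ∫ w in Set.Ioo (0 : ℝ) 1, w ^ (s / 2 - 1) *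
          ((1 - w) ^ (((Module.finrank ℝ E : ℝ) - s) / 2 - 1) * exp (-(w * ‖x‖ ^ 2 * t))) := by
  set d : ℝ := (Module.finrank ℝ E : ℝ) with hd
  have hne : ∀ᵐ y : E, y ≠ 0 := Measure.ae_ne volume 0
  set Φ : E → ℝ → ℝ := fun y u =>
    u ^ (s / 2 - 1) * exp (-(‖y‖ ^ 2 * u)) * exp (-(t * ‖x - y‖ ^ 2)) with hΦ
  have hint : ∀ y : E, y ≠ 0 →
      ∫ u in Set.Ioi (0 : ℝ), Φ y u =
        Gamma (s / 2) * (‖y‖ ^ (-s) * exp (-(t * ‖x - y‖ ^ 2))) := fun y hy => by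
    have := integral_rpow_mul_exp_mul_norm_sq hs0 one_pos hy
    simp only [one_mul, Real.one_rpow] at this
    simp only [hΦ]
    rw [integral_mul_const, this]; ring
  have hΦm : Measurable (Function.uncurry Φ) := by
    simp only [hΦ, Function.uncurry_def]; fun_prop
  have hΦi : Integrable (Function.uncurry Φ)
      ((volume : Measure E).prod (volume.restrict (Set.Ioi (0 : ℝ)))) := by
    refine (integrable_prod_iff hΦm.aestronglyMeasurable).2 ⟨?_, ?_⟩
    · filter_upwards [hne] with y hy
      have hy' : 0 < ‖y‖ := norm_pos_iff.2 hy
      have h : IntegrableOn (fun u : ℝ => u ^ (s / 2 - 1) * exp (-(‖y‖ ^ 2 * u))) (Set.Ioi 0) :=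
        integrableOn_rpow_sub_one_mul_exp (by linarith) (by positivity)
      exact Integrable.mul_const h (exp (-(t * ‖x - y‖ ^ 2)))
    · refine ((integrable_norm_rpow_mul_exp hs0.le hs ht x).const_mul (Gamma (s / 2))).congr ?_
      filter_upwards [hne] with y hy
      rw [← hint y hy]
      refine setIntegral_congr_fun measurableSet_Ioi fun u hu => ?_
      have hu : 0 < u := hu
      simp only [Function.uncurry_apply_pair, hΦ]
      rw [Real.norm_of_nonneg (by positivity)]
  have hswap := integral_integral_swap hΦi
  rw [← integral_const_mul, ← integral_congr_ae (hne.mono hint), hswap,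
    ← image_mul_div_one_sub ht,
    integral_image_eq_integral_abs_deriv_smul measurableSet_Ioo
      (f' := fun w => t / (1 - w) ^ 2) ?_ (injOn_mul_div_one_sub ht), ← integral_const_mul]
  · refine setIntegral_congr_fun measurableSet_Ioo fun w hw => ?_
    have hw0 : 0 < w := hw.1
    have hw1 : 0 < 1 - w := by linarith [hw.2]
    have hu : 0 < t * w / (1 - w) := by positivity
    have e : ∀ y : E, Φ y (t * w / (1 - w)) = (t * w / (1 - w)) ^ (s / 2 - 1) *
        (exp (-(t * w / (1 - w) * ‖y‖ ^ 2)) * exp (-(t * ‖x - y‖ ^ 2))) := fun y => by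
      simp only [hΦ]
      rw [mul_assoc, mul_comm (‖y‖ ^ 2)]
    simp only [e]
    rw [integral_const_mul, integral_exp_mul_exp_neg_norm_sq ht hu, ← hd]
    have h1 : t + t * w / (1 - w) = t / (1 - w) := by field_simp; ring
    have h2 : t * (t * w / (1 - w)) / (t + t * w / (1 - w)) * ‖x‖ ^ 2 = w * ‖x‖ ^ 2 * t := by
      rw [h1]; field_simp
    rw [h2, h1, abs_of_pos (by positivity), smul_eq_mul]
    have h3 : π / (t / (1 - w)) = (π / t) * (1 - w) := by field_simp
    have hπ : 0 ≤ π / t := by positivity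
    rw [h3, Real.mul_rpow hπ hw1.le, Real.div_rpow (by positivity) hw1.le,
      Real.mul_rpow ht.le hw0.le]
    have h4 : t ^ (s / 2) = t ^ (s / 2 - 1) * t := by
      rw [← Real.rpow_add_one ht.ne']; ring_nf
    have h5 : (1 - w) ^ (d / 2) = (1 - w) ^ ((d - s) / 2 - 1) * ((1 - w) ^ (s / 2 - 1)
        * (1 - w) ^ 2) := by
      rw [← Real.rpow_natCast (1 - w) 2, ← Real.rpow_add hw1, ← Real.rpow_add hw1]
      congr 1; push_cast; ring
    have h6 : (1 - w) ^ (s / 2 - 1) ≠ 0 := (Real.rpow_pos_of_pos hw1 _).ne'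
    rw [h4, h5]
    field_simp
  · intro w hw
    have hw1 : 1 - w ≠ 0 := by linarith [hw.2]
    have := ((hasDerivAt_id w).const_mul t).div ((hasDerivAt_id w).const_sub 1) hw1
    refine (this.congr_deriv ?_).hasDerivWithinAt
    simp only [id]
    field_simp
    ring

/-- The Gauss transform of the increment `‖x‖ ^ (-s) - ‖y‖ ^ (-s)`. -/
theorem Gamma_mul_integral_sub_mul_exp [Nontrivial E] {s t : ℝ} (hs0 : 0 < s)
    (hs : s < Module.finrank ℝ E) (ht : 0 < t) {x : E} (hx : x ≠ 0) :
    Gamma (s / 2) * ∫ y : E, (‖x‖ ^ (-s) - ‖y‖ ^ (-s)) * exp (-(t * ‖x - y‖ ^ 2)) =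
      (π / t) ^ ((Module.finrank ℝ E : ℝ) / 2) * t ^ (s / 2) *
        ∫ w in Set.Ioi (0 : ℝ), w ^ (s / 2 - 1) *
          (powDefect (((Module.finrank ℝ E : ℝ) - s) / 2) w * exp (-(w * ‖x‖ ^ 2 * t))) := by
  have hx' : 0 < ‖x‖ := norm_pos_iff.2 hx
  simp only [sub_mul]
  rw [integral_sub ((integrable_exp_neg_mul_norm_sub_sq ht x).const_mul _)
    (integrable_norm_rpow_mul_exp hs0.le hs ht x), mul_sub,
    Gamma_mul_integral_norm_rpow_mul_exp hs0 hs ht, integral_const_mul,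
    integral_exp_neg_mul_norm_sub_sq ht]
  set d : ℝ := (Module.finrank ℝ E : ℝ) with hd
  have hfull := integral_rpow_mul_exp_mul_norm_sq (x := x) hs0 ht hx
  have hfulli : IntegrableOn (fun w : ℝ => w ^ (s / 2 - 1) * exp (-(w * ‖x‖ ^ 2 * t)))
      (Set.Ioi 0) := by
    refine (integrableOn_rpow_sub_one_mul_exp (q := s / 2) (r := t * ‖x‖ ^ 2) (by linarith)
      (by positivity)).congr_fun (fun w _ => ?_) measurableSet_Ioi
    simp only; ring_nf
  have hparti : IntegrableOn (fun w : ℝ => w ^ (s / 2 - 1) *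
      ((1 - w) ^ ((d - s) / 2 - 1) * exp (-(w * ‖x‖ ^ 2 * t)))) (Set.Ioo 0 1) := by
    refine Integrable.mono' (integrableOn_beta (u := s / 2) (v := (d - s) / 2) (by linarith)
      (by linarith)) (Measurable.aestronglyMeasurable (by fun_prop)) ?_
    refine (ae_restrict_iff' measurableSet_Ioo).2 (.of_forall fun w hw => ?_)
    have hw0 : 0 < w := hw.1
    have hw1 : 0 < 1 - w := by linarith [hw.2]
    rw [Real.norm_of_nonneg (by positivity)]
    have : exp (-(w * ‖x‖ ^ 2 * t)) ≤ 1 := Real.exp_le_one_iff.2 (by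
      have : 0 ≤ w * ‖x‖ ^ 2 * t := by positivity
      linarith)
    rw [← mul_assoc]
    exact mul_le_of_le_one_right (by positivity) this
  have hsplit : ∀ w ∈ Set.Ioi (0 : ℝ), w ^ (s / 2 - 1) *
      (powDefect ((d - s) / 2) w * exp (-(w * ‖x‖ ^ 2 * t))) =
      w ^ (s / 2 - 1) * exp (-(w * ‖x‖ ^ 2 * t)) - (Set.Ioo (0 : ℝ) 1).indicator (fun w =>
        w ^ (s / 2 - 1) * ((1 - w) ^ ((d - s) / 2 - 1) * exp (-(w * ‖x‖ ^ 2 * t)))) w := by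
    intro w hw
    have hw : 0 < w := hw
    by_cases h1 : w < 1
    · rw [Set.indicator_of_mem (Set.mem_Ioo.2 ⟨hw, h1⟩)]
      simp only [powDefect, h1, if_true]; ring
    · rw [Set.indicator_of_notMem (fun h => h1 h.2)]
      simp only [powDefect, h1, if_false]; ring
  rw [setIntegral_congr_fun measurableSet_Ioi hsplit, integral_sub hfulli
    ((integrable_indicator_iff measurableSet_Ioo).2 hparti).integrableOn,
    setIntegral_indicator measurableSet_Ioo, mul_sub,
    Set.inter_eq_right.2 Set.Ioo_subset_Ioi_self]
  congr 1
  have e : ∫ w in Set.Ioi (0 : ℝ), w ^ (s / 2 - 1) * exp (-(w * ‖x‖ ^ 2 * t)) =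
      t ^ (-(s / 2)) * (‖x‖ ^ (-s) * Gamma (s / 2)) := by
    rw [← hfull]
    refine setIntegral_congr_fun measurableSet_Ioi fun w _ => ?_
    ring_nf
  have h7 : t ^ (s / 2) * t ^ (-(s / 2)) = 1 := by
    rw [← Real.rpow_add ht]; simp
  rw [e]
  linear_combination (-(Gamma (s / 2) * ‖x‖ ^ (-s) * (π / t) ^ (d / 2))) * h7

/-- Symmetrization of the Gaussian form: only one of the two increments has to be kept. -/
theorem integral_sub_mul_sub_mul_exp [Nontrivial E] {s t : ℝ} (hs0 : 0 < s)
    (hs : s < Module.finrank ℝ E) (ht : 0 < t) {f : E → ℝ} (hf : Integrable f)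
    (hfs : Integrable fun x => f x * ‖x‖ ^ (-s)) :
    ∫ z : E × E, (f z.1 - f z.2) * (‖z.1‖ ^ (-s) - ‖z.2‖ ^ (-s)) *
        exp (-(t * ‖z.1 - z.2‖ ^ 2)) =
      2 * ∫ x : E, f x * ∫ y : E, (‖x‖ ^ (-s) - ‖y‖ ^ (-s)) * exp (-(t * ‖x - y‖ ^ 2)) := by
  set J : E × E → ℝ := fun z =>
    f z.1 * ((‖z.1‖ ^ (-s) - ‖z.2‖ ^ (-s)) * exp (-(t * ‖z.1 - z.2‖ ^ 2))) with hJ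
  have hJi : Integrable J := by
    refine ((integrable_mul_comp_sub hfs (integrable_exp_neg_mul_norm_sq (E := E) ht)).sub
      (integrable_prod_norm_rpow_mul_exp hs0.le hs ht hf)).congr (.of_forall fun z => ?_)
    simp only [hJ, Pi.sub_apply]; ring
  have e : ∀ z : E × E, (f z.1 - f z.2) * (‖z.1‖ ^ (-s) - ‖z.2‖ ^ (-s)) *
      exp (-(t * ‖z.1 - z.2‖ ^ 2)) = J z + J z.swap := fun z => by
    simp only [hJ, Prod.fst_swap, Prod.snd_swap, norm_sub_rev z.2 z.1]; ring
  simp only [e]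
  have hsw : Integrable (fun z : E × E => J z.swap) := hJi.swap
  have hI : ∫ z : E × E, J z.swap = ∫ z : E × E, J z := integral_prod_swap J
  rw [integral_add hJi hsw, hI, ← two_mul, Measure.volume_eq_prod, integral_prod J hJi]
  simp only [hJ, integral_const_mul]

/-- The pairing of a function with the fractional Laplacian of `‖x‖ ^ (-s)`, given by heat
subordination. -/
theorem integral_rpow_mul_integral_sub_mul_exp [Nontrivial E] {a s : ℝ} (ha0 : 0 < a)
    (ha2 : a < 2) (hs0 : 0 < s) (hs : s + a < Module.finrank ℝ E) {f : E → ℝ}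
    (hfm : Measurable f) (hfsa : Integrable fun x => f x * ‖x‖ ^ (-(s + a))) :
    Gamma (s / 2) * ∫ t in Set.Ioi (0 : ℝ), t ^ (((Module.finrank ℝ E : ℝ) + a) / 2 - 1) *
        ∫ x : E, f x * ∫ y : E, (‖x‖ ^ (-s) - ‖y‖ ^ (-s)) * exp (-(t * ‖x - y‖ ^ 2)) =
      π ^ ((Module.finrank ℝ E : ℝ) / 2) * Gamma ((s + a) / 2) *
        (Gamma (1 - a / 2) / (a / 2) * Gamma (((Module.finrank ℝ E : ℝ) - s) / 2) /
          Gamma (((Module.finrank ℝ E : ℝ) - s) / 2 - a / 2)) *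
        ∫ x : E, f x * ‖x‖ ^ (-(s + a)) := by
  set d : ℝ := (Module.finrank ℝ E : ℝ) with hd
  have hne : ∀ᵐ x : E, x ≠ 0 := Measure.ae_ne volume 0
  obtain ⟨hki, hkI⟩ := integral_powDefect (p := a / 2) (β := (d - s) / 2) (by linarith)
    (by linarith) (by linarith)
  set Ψ : E × ℝ → ℝ → ℝ := fun z t => f z.1 * (z.2 ^ (s / 2 - 1) * powDefect ((d - s) / 2) z.2) *
    (t ^ ((s + a) / 2 - 1) * exp (-(z.2 * ‖z.1‖ ^ 2 * t))) with hΨ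
  have hΨm : Measurable (Function.uncurry Ψ) := by
    simp only [hΨ, Function.uncurry_def]; fun_prop
  set μ : Measure (E × ℝ) := (volume : Measure E).prod (volume.restrict (Set.Ioi (0 : ℝ))) with hμ
  have hae : ∀ᵐ z ∂μ, z.1 ≠ 0 ∧ 0 < z.2 := by
    have h1 : ∀ᵐ z ∂μ, z.1 ≠ 0 := Measure.quasiMeasurePreserving_fst.ae hne
    have h2 : ∀ᵐ z ∂μ, z.2 ∈ Set.Ioi (0 : ℝ) :=
      Measure.quasiMeasurePreserving_snd.ae (ae_restrict_mem measurableSet_Ioi)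
    filter_upwards [h1, h2] with z h1 h2 using ⟨h1, h2⟩
  have hgam : ∀ z : E × ℝ, z.1 ≠ 0 → 0 < z.2 →
      z.2 ^ (s / 2 - 1) *
        ∫ t in Set.Ioi (0 : ℝ), t ^ ((s + a) / 2 - 1) * exp (-(z.2 * ‖z.1‖ ^ 2 * t)) =
      Gamma ((s + a) / 2) * (‖z.1‖ ^ (-(s + a)) * z.2 ^ (-(a / 2) - 1)) := fun z h1 h2 => by
    rw [integral_rpow_mul_exp_mul_norm_sq (by linarith) h2 h1, ← mul_assoc, ← Real.rpow_add h2]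
    have : s / 2 - 1 + -((s + a) / 2) = -(a / 2) - 1 := by ring
    rw [this]; ring
  have hΨint : ∀ᵐ z ∂μ, ∫ t in Set.Ioi (0 : ℝ), Ψ z t = Gamma ((s + a) / 2) *
      ((f z.1 * ‖z.1‖ ^ (-(s + a))) * (z.2 ^ (-(a / 2) - 1) * powDefect ((d - s) / 2) z.2)) := by
    filter_upwards [hae] with z hz
    simp only [hΨ]
    rw [integral_const_mul]
    linear_combination (f z.1 * powDefect ((d - s) / 2) z.2) * hgam z hz.1 hz.2
  have hΨi : Integrable (Function.uncurry Ψ) (μ.prod (volume.restrict (Set.Ioi (0 : ℝ)))) := by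
    refine (integrable_prod_iff hΨm.aestronglyMeasurable).2 ⟨?_, ?_⟩
    · filter_upwards [hae] with z hz
      have hz1 : 0 < ‖z.1‖ := norm_pos_iff.2 hz.1
      have hz2 := hz.2
      have h : IntegrableOn (fun t : ℝ => t ^ ((s + a) / 2 - 1) *
          exp (-(z.2 * ‖z.1‖ ^ 2 * t))) (Set.Ioi 0) :=
        integrableOn_rpow_sub_one_mul_exp (by linarith) (by positivity)
      exact Integrable.const_mul h (f z.1 * (z.2 ^ (s / 2 - 1) * powDefect ((d - s) / 2) z.2))
    · refine ((hfsa.mul_prod hki).norm.const_mul (Gamma ((s + a) / 2))).congr ?_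
      filter_upwards [hae] with z hz
      have hz2 := hz.2
      have e : ∀ t ∈ Set.Ioi (0 : ℝ), ‖Function.uncurry Ψ (z, t)‖ =
          (|f z.1| * (z.2 ^ (s / 2 - 1) * |powDefect ((d - s) / 2) z.2|)) *
          (t ^ ((s + a) / 2 - 1) * exp (-(z.2 * ‖z.1‖ ^ 2 * t))) := fun t ht => by
        have ht : 0 < t := ht
        simp only [Function.uncurry_apply_pair, hΨ, Real.norm_eq_abs, abs_mul]
        rw [abs_of_pos (Real.exp_pos _), abs_of_nonneg (show 0 ≤ t ^ ((s + a) / 2 - 1) by positivity),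
          abs_of_nonneg (show 0 ≤ z.2 ^ (s / 2 - 1) by positivity)]
      rw [setIntegral_congr_fun measurableSet_Ioi e, integral_const_mul]
      simp only [Real.norm_eq_abs, abs_mul]
      rw [abs_of_nonneg (show 0 ≤ ‖z.1‖ ^ (-(s + a)) by positivity),
        abs_of_nonneg (show 0 ≤ z.2 ^ (-(a / 2) - 1) by positivity)]
      linear_combination (-(|f z.1| * |powDefect ((d - s) / 2) z.2|)) * hgam z hz.1 hz.2
  have hswap := integral_integral_swap hΨi
  rw [integral_congr_ae hΨint, integral_const_mul, hμ,
    integral_prod_mul (fun x : E => f x * ‖x‖ ^ (-(s + a)))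
      (fun w : ℝ => w ^ (-(a / 2) - 1) * powDefect ((d - s) / 2) w), hkI] at hswap
  have hleft : ∀ᵐ t ∂(volume.restrict (Set.Ioi (0 : ℝ))),
      Gamma (s / 2) * (t ^ ((d + a) / 2 - 1) *
        ∫ x : E, f x * ∫ y : E, (‖x‖ ^ (-s) - ‖y‖ ^ (-s)) * exp (-(t * ‖x - y‖ ^ 2))) =
      π ^ (d / 2) * ∫ z, Ψ z t ∂μ := by
    filter_upwards [hΨi.prod_left_ae, ae_restrict_mem measurableSet_Ioi] with t hti ht
    have ht : 0 < t := ht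
    have hprod : ∫ z, Ψ z t ∂μ = _ := integral_prod _ hti
    rw [hprod, mul_left_comm, ← integral_const_mul, ← integral_const_mul,
      ← integral_const_mul]
    refine integral_congr_ae ?_
    filter_upwards [hne] with x hx
    have h1 := Gamma_mul_integral_sub_mul_exp hs0 (by linarith : s < Module.finrank ℝ E) ht hx
    rw [← hd] at h1
    have h2 : t ^ ((d + a) / 2 - 1) * ((π / t) ^ (d / 2) * t ^ (s / 2)) =
        π ^ (d / 2) * t ^ ((s + a) / 2 - 1) := by
      rw [Real.div_rpow Real.pi_pos.le ht.le]
      have : t ^ ((d + a) / 2 - 1) * t ^ (s / 2) = t ^ ((s + a) / 2 - 1) * t ^ (d / 2) := by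
        rw [← Real.rpow_add ht, ← Real.rpow_add ht]; congr 1; ring
      have h3 : t ^ (d / 2) ≠ 0 := (Real.rpow_pos_of_pos ht _).ne'
      rw [div_mul_eq_mul_div, mul_div_assoc', div_eq_iff h3]
      linear_combination π ^ (d / 2) * this
    have h4 : ∫ w in Set.Ioi (0 : ℝ), Ψ (x, w) t =
        (f x * t ^ ((s + a) / 2 - 1)) * ∫ w in Set.Ioi (0 : ℝ), w ^ (s / 2 - 1) *
          (powDefect ((d - s) / 2) w * exp (-(w * ‖x‖ ^ 2 * t))) := by
      rw [← integral_const_mul]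
      congr 1 with w
      simp only [hΨ]; ring
    rw [h4]
    set K := ∫ w in Set.Ioi (0 : ℝ), w ^ (s / 2 - 1) *
          (powDefect ((d - s) / 2) w * exp (-(w * ‖x‖ ^ 2 * t)))
    linear_combination (t ^ ((d + a) / 2 - 1) * f x) * h1 + f x * K * h2
  rw [← integral_const_mul, integral_congr_ae hleft, integral_const_mul, hμ, ← hswap]
  ring

/-- Evaluation of the fractional form of order `a` on the pair `(f, ‖x‖ ^ (-s))`. -/
theorem integral_sub_mul_sub_div_norm_rpow [Nontrivial E] {a s : ℝ} (ha0 : 0 < a)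
    (ha2 : a < 2) (hs0 : 0 < s) (hs : s + a < Module.finrank ℝ E) {f : E → ℝ}
    (hfm : Measurable f) (hf : Integrable f) (hfs : Integrable fun x => f x * ‖x‖ ^ (-s))
    (hfsa : Integrable fun x => f x * ‖x‖ ^ (-(s + a)))
    (hint : Integrable fun z : E × E => (f z.1 - f z.2) * (‖z.1‖ ^ (-s) - ‖z.2‖ ^ (-s)) /
      ‖z.1 - z.2‖ ^ ((Module.finrank ℝ E : ℝ) + a)) :
    Gamma (s / 2) * (Gamma (((Module.finrank ℝ E : ℝ) + a) / 2) *
      ∫ z : E × E, (f z.1 - f z.2) * (‖z.1‖ ^ (-s) - ‖z.2‖ ^ (-s)) /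
        ‖z.1 - z.2‖ ^ ((Module.finrank ℝ E : ℝ) + a)) =
      2 * (π ^ ((Module.finrank ℝ E : ℝ) / 2) * Gamma ((s + a) / 2) *
        (Gamma (1 - a / 2) / (a / 2) * Gamma (((Module.finrank ℝ E : ℝ) - s) / 2) /
          Gamma (((Module.finrank ℝ E : ℝ) - s) / 2 - a / 2)) *
        ∫ x : E, f x * ‖x‖ ^ (-(s + a))) := by
  rw [← integral_rpow_mul_integral_sub_mul_exp ha0 ha2 hs0 hs hfm hfsa]
  set d : ℝ := (Module.finrank ℝ E : ℝ) with hd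
  have hdpos : 0 < d + a := by linarith
  set D : E × E → ℝ := fun z => (f z.1 - f z.2) * (‖z.1‖ ^ (-s) - ‖z.2‖ ^ (-s)) with hD
  set Φ : E × E → ℝ → ℝ := fun z t =>
    D z * (t ^ ((d + a) / 2 - 1) * exp (-(‖z.1 - z.2‖ ^ 2 * t))) with hΦ
  have hΦm : Measurable (Function.uncurry Φ) := by
    simp only [hΦ, hD, Function.uncurry_def]; fun_prop
  have hD0 : ∀ z : E × E, z.1 - z.2 = 0 → D z = 0 := fun z hz => by
    simp [hD, sub_eq_zero.1 hz]
  have hgam : ∀ z : E × E, z.1 - z.2 ≠ 0 →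
      ∫ t in Set.Ioi (0 : ℝ), t ^ ((d + a) / 2 - 1) * exp (-(‖z.1 - z.2‖ ^ 2 * t)) =
        Gamma ((d + a) / 2) / ‖z.1 - z.2‖ ^ (d + a) := fun z hz => by
    have := integral_rpow_mul_exp_mul_norm_sq hdpos one_pos hz
    simp only [one_mul, Real.one_rpow] at this
    rw [this, Real.rpow_neg (norm_nonneg _)]
    ring
  have hΦint : ∀ z, ∫ t in Set.Ioi (0 : ℝ), Φ z t =
      Gamma ((d + a) / 2) * (D z / ‖z.1 - z.2‖ ^ (d + a)) := fun z => by
    simp only [hΦ]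
    rw [integral_const_mul]
    by_cases hz : z.1 - z.2 = 0
    · simp [hD0 z hz]
    · rw [hgam z hz]; ring
  have hΦi : Integrable (Function.uncurry Φ)
      ((volume : Measure (E × E)).prod (volume.restrict (Set.Ioi (0 : ℝ)))) := by
    refine (integrable_prod_iff hΦm.aestronglyMeasurable).2 ⟨.of_forall fun z => ?_, ?_⟩
    · by_cases hz : z.1 - z.2 = 0
      · simp [hΦ, hD0 z hz]
      · have hz1 : 0 < ‖z.1 - z.2‖ := norm_pos_iff.2 hz
        have h : IntegrableOn (fun t : ℝ => t ^ ((d + a) / 2 - 1) *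
            exp (-(‖z.1 - z.2‖ ^ 2 * t))) (Set.Ioi 0) :=
          integrableOn_rpow_sub_one_mul_exp (by linarith) (by positivity)
        exact Integrable.const_mul h (D z)
    · refine (hint.norm.const_mul (Gamma ((d + a) / 2))).congr (.of_forall fun z => ?_)
      have e : ∀ t ∈ Set.Ioi (0 : ℝ), ‖Function.uncurry Φ (z, t)‖ =
          |D z| * (t ^ ((d + a) / 2 - 1) * exp (-(‖z.1 - z.2‖ ^ 2 * t))) := fun t ht => by
        have ht : 0 < t := ht
        simp only [Function.uncurry_apply_pair, hΦ, Real.norm_eq_abs, abs_mul]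
        rw [abs_of_pos (Real.exp_pos _),
          abs_of_nonneg (show 0 ≤ t ^ ((d + a) / 2 - 1) by positivity)]
      change Gamma ((d + a) / 2) * ‖D z / ‖z.1 - z.2‖ ^ (d + a)‖ =
        ∫ t in Set.Ioi (0 : ℝ), ‖Function.uncurry Φ (z, t)‖
      rw [setIntegral_congr_fun measurableSet_Ioi e, integral_const_mul]
      by_cases hz : z.1 - z.2 = 0
      · simp [hD0 z hz]
      · rw [hgam z hz, norm_div, Real.norm_eq_abs, Real.norm_of_nonneg (by positivity)]; ring
  have hswap := integral_integral_swap hΦi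
  simp only [hΦint] at hswap
  rw [integral_const_mul] at hswap
  rw [hswap, mul_left_comm 2]
  congr 1
  rw [← integral_const_mul]
  refine setIntegral_congr_fun measurableSet_Ioi fun t ht => ?_
  have ht : 0 < t := ht
  have h := integral_sub_mul_sub_mul_exp hs0 (by linarith : s < Module.finrank ℝ E) ht hf hfs
  rw [mul_left_comm, ← h, ← integral_const_mul]
  congr 1 with z
  simp only [hΦ, hD]
  rw [mul_comm t]; ring

theorem integrable_indicator_ball_norm_rpow [Nontrivial E] {p : ℝ} (hp : p < Module.finrank ℝ E)
    (r : ℝ) : Integrable ((Metric.ball (0 : E) r).indicator fun z => ‖z‖ ^ (-p)) := by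
  refine (integrable_indicator_iff Metric.isOpen_ball.measurableSet).2 ?_
  refine integrableOn_ball_of_norm_le_rpow (C := 1) (α := p) ?_ hp ?_ ?_
  · exact Module.finrank_pos
  · refine .of_forall fun x => ?_
    rw [Real.norm_of_nonneg (by positivity), one_mul]
  · exact Measurable.aestronglyMeasurable (by fun_prop)

theorem integrable_indicator_compl_ball_norm_rpow {q r : ℝ} (hq : Module.finrank ℝ E < q)
    (hr : 0 < r) : Integrable ((Metric.ball (0 : E) r)ᶜ.indicator fun z => ‖z‖ ^ (-q)) := by
  have hq0 : 0 < q := lt_of_le_of_lt (Nat.cast_nonneg _) hq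
  refine ((integrable_one_add_norm (μ := (volume : Measure E)) hq).const_mul
    ((1 + r⁻¹) ^ q)).mono' ?_ (.of_forall fun z => ?_)
  · exact ((Measurable.indicator (by fun_prop)
      Metric.isOpen_ball.measurableSet.compl).aestronglyMeasurable)
  · by_cases hz : z ∈ Metric.ball (0 : E) r
    · rw [Set.indicator_of_notMem (by simpa using hz), norm_zero]
      positivity
    · rw [Set.indicator_of_mem hz, Real.norm_of_nonneg (by positivity)]
      have hz : r ≤ ‖z‖ := by simpa using hz
      have hz0 : 0 < ‖z‖ := hr.trans_le hz
      have h : 1 + ‖z‖ ≤ (1 + r⁻¹) * ‖z‖ := by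
        have : 1 ≤ r⁻¹ * ‖z‖ := by
          rw [inv_mul_eq_div, le_div_iff₀ hr]; linarith
        linarith
      have h2 : (1 + ‖z‖) ^ q ≤ (1 + r⁻¹) ^ q * ‖z‖ ^ q := by
        rw [← Real.mul_rpow (by positivity) hz0.le]
        exact Real.rpow_le_rpow (by positivity) h hq0.le
      rw [Real.rpow_neg hz0.le, Real.rpow_neg (by positivity), ← div_eq_mul_inv,
        le_div_iff₀ (by positivity), inv_mul_le_iff₀ (by positivity)]
      linarith

/-- The integrand of the fractional form is integrable for Lipschitz functions supported away
from the origin. -/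
theorem integrable_sub_mul_sub_div_norm_rpow [Nontrivial E] {a s r L M : ℝ} (ha0 : 0 < a)
    (ha2 : a < 2) (hs0 : 0 < s) (hs : s < Module.finrank ℝ E) (hr : 0 < r) {f : E → ℝ}
    (hfc : Continuous f) (hL : ∀ x y, |f x - f y| ≤ L * ‖x - y‖) (hM : ∀ x, |f x| ≤ M)
    {K : Set E} (hK : IsCompact K) (hKr : ∀ x ∈ K, r ≤ ‖x‖) (hfK : ∀ x ∉ K, f x = 0) :
    Integrable fun z : E × E => (f z.1 - f z.2) * (‖z.1‖ ^ (-s) - ‖z.2‖ ^ (-s)) /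
      ‖z.1 - z.2‖ ^ ((Module.finrank ℝ E : ℝ) + a) := by
  set d : ℝ := (Module.finrank ℝ E : ℝ) with hd
  have hd0 : 0 ≤ d := Nat.cast_nonneg _
  have hL0 : 0 ≤ L := by
    obtain ⟨x, hx⟩ := exists_ne (0 : E)
    have := (abs_nonneg _).trans (hL x 0)
    rw [sub_zero] at this
    exact nonneg_of_mul_nonneg_left this (norm_pos_iff.2 hx)
  have hM0 : 0 ≤ M := (abs_nonneg _).trans (hM 0)
  set φ : E → ℝ := fun z => (Metric.ball (0 : E) (r / 2)).indicator (fun z => ‖z‖ ^ (-(d + a - 2))) z +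
    (Metric.ball (0 : E) (r / 2))ᶜ.indicator (fun z => ‖z‖ ^ (-(d + a))) z with hφ
  have hφi : Integrable φ :=
    (integrable_indicator_ball_norm_rpow (by linarith) _).add
      (integrable_indicator_compl_ball_norm_rpow (by linarith) (by linarith))
  have hφ0 : ∀ z, 0 ≤ φ z := fun z => add_nonneg
    (Set.indicator_nonneg (fun _ _ => by positivity) z)
    (Set.indicator_nonneg (fun _ _ => by positivity) z)
  have hφn : ∀ z, ‖z‖ < r / 2 → ‖z‖ * ‖z‖ / ‖z‖ ^ (d + a) ≤ φ z := fun z hz => by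
    rcases eq_or_ne z 0 with rfl | hz0
    · simpa using hφ0 0
    have hz1 : 0 < ‖z‖ := norm_pos_iff.2 hz0
    have hm : z ∈ Metric.ball (0 : E) (r / 2) := by simpa using hz
    simp only [hφ]
    rw [Set.indicator_of_mem hm, Set.indicator_of_notMem (by simpa using hm), add_zero,
      ← sq, ← Real.rpow_two, ← Real.rpow_sub hz1]
    exact le_of_eq (by congr 1; ring)
  have hφf : ∀ z, r / 2 ≤ ‖z‖ → (‖z‖ ^ (d + a))⁻¹ ≤ φ z := fun z hz => by
    have hm : z ∉ Metric.ball (0 : E) (r / 2) := by simpa using hz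
    simp only [hφ]
    rw [Set.indicator_of_notMem hm, Set.indicator_of_mem (by simpa using hz), zero_add,
      ← Real.rpow_neg (norm_nonneg _)]
  set C₁ : ℝ := L * (s * (r / 2) ^ (-s - 1)) + 2 * M * (r ^ (-s) + 1) with hC₁
  set C₂ : ℝ := 2 * M * ((r / 2) ^ (d + a))⁻¹ with hC₂
  have hC₁0 : 0 ≤ C₁ := by positivity
  have hC₂0 : 0 ≤ C₂ := by positivity
  set χ : E → ℝ := K.indicator fun _ => 1 with hχ
  have hχi : Integrable χ :=
    (integrable_indicator_iff hK.isClosed.measurableSet).2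
      (integrableOn_const hK.measure_lt_top.ne)
  set B : E × E → ℝ := fun z => C₁ * (χ z.1 * φ (z.1 - z.2)) + C₂ * (χ z.1 * rieszBall E s z.2)
    with hB
  have hBi : Integrable B :=
    ((integrable_mul_comp_sub hχi hφi).const_mul C₁).add
      ((hχi.mul_prod (integrable_rieszBall hs)).const_mul C₂)
  have hχ0 : ∀ x, 0 ≤ χ x := fun x => Set.indicator_nonneg (fun _ _ => zero_le_one) x
  have hB0 : ∀ z, 0 ≤ B z := fun z =>
    add_nonneg (mul_nonneg hC₁0 (mul_nonneg (hχ0 _) (hφ0 _)))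
      (mul_nonneg hC₂0 (mul_nonneg (hχ0 _) (rieszBall_nonneg _ _)))
  set I : E × E → ℝ := fun z => (f z.1 - f z.2) * (‖z.1‖ ^ (-s) - ‖z.2‖ ^ (-s)) /
      ‖z.1 - z.2‖ ^ (d + a) with hI
  have key : ∀ z : E × E, z.1 ∈ K → |I z| ≤ B z := by
    rintro ⟨x, y⟩ hx
    have hx : x ∈ K := hx
    have hxr := hKr x hx
    have hχx : χ x = 1 := Set.indicator_of_mem hx _
    simp only [hI, hB, hχx, one_mul]
    rw [abs_div, abs_mul, abs_of_nonneg (show 0 ≤ ‖x - y‖ ^ (d + a) by positivity)]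
    have hR0 := rieszBall_nonneg (E := E) s y
    rcases lt_or_ge ‖x - y‖ (r / 2) with h | h
    · have hy : r / 2 ≤ ‖y‖ := by
        have := norm_sub_norm_le x y
        linarith
      have h1 : |‖x‖ ^ (-s) - ‖y‖ ^ (-s)| ≤ s * (r / 2) ^ (-s - 1) * ‖x - y‖ :=
        (abs_rpow_neg_sub_rpow_neg_le hs0.le (by linarith) (by linarith) hy).trans
          (mul_le_mul_of_nonneg_left (abs_norm_sub_norm_le x y) (by positivity))
      calc |f x - f y| * |‖x‖ ^ (-s) - ‖y‖ ^ (-s)| / ‖x - y‖ ^ (d + a)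
          ≤ (L * ‖x - y‖) * (s * (r / 2) ^ (-s - 1) * ‖x - y‖) / ‖x - y‖ ^ (d + a) := by
            gcongr
            exact hL x y
        _ = L * (s * (r / 2) ^ (-s - 1)) * (‖x - y‖ * ‖x - y‖ / ‖x - y‖ ^ (d + a)) := by ring
        _ ≤ C₁ * φ (x - y) := by
            refine mul_le_mul ?_ (hφn _ h) (by positivity) hC₁0
            have : 0 ≤ 2 * M * (r ^ (-s) + 1) := by positivity
            linarith
        _ ≤ _ := le_add_of_nonneg_right (mul_nonneg hC₂0 hR0)
    · have h1 : |f x - f y| ≤ 2 * M := (abs_sub _ _).trans (by linarith [hM x, hM y])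
      have h2 : |‖x‖ ^ (-s) - ‖y‖ ^ (-s)| ≤ (r ^ (-s) + 1) + rieszBall E s y := by
        refine (abs_sub _ _).trans ?_
        rw [abs_of_nonneg (show 0 ≤ ‖x‖ ^ (-s) by positivity),
          abs_of_nonneg (show 0 ≤ ‖y‖ ^ (-s) by positivity)]
        have := norm_rpow_neg_le hs0.le y
        have := Real.rpow_le_rpow_of_nonpos hr hxr (by linarith : -s ≤ 0)
        linarith
      have h3 : (‖x - y‖ ^ (d + a))⁻¹ ≤ ((r / 2) ^ (d + a))⁻¹ :=
        inv_anti₀ (by positivity) (Real.rpow_le_rpow (by positivity) h (by positivity))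
      calc |f x - f y| * |‖x‖ ^ (-s) - ‖y‖ ^ (-s)| / ‖x - y‖ ^ (d + a)
          ≤ (2 * M) * ((r ^ (-s) + 1) + rieszBall E s y) / ‖x - y‖ ^ (d + a) := by
            gcongr
        _ = 2 * M * (r ^ (-s) + 1) * (‖x - y‖ ^ (d + a))⁻¹ +
            2 * M * (‖x - y‖ ^ (d + a))⁻¹ * rieszBall E s y := by ring
        _ ≤ C₁ * φ (x - y) + C₂ * rieszBall E s y := by
            refine add_le_add (mul_le_mul ?_ (hφf _ h) (by positivity) hC₁0) ?_
            · have : 0 ≤ L * (s * (r / 2) ^ (-s - 1)) := by positivity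
              linarith
            · simp only [hC₂]
              gcongr
  have hIs : ∀ z : E × E, I z.swap = I z := fun z => by
    simp only [hI, Prod.fst_swap, Prod.snd_swap, norm_sub_rev z.2 z.1]; ring
  have hsw : Integrable fun z : E × E => B z.swap := hBi.swap
  refine (hBi.add hsw).mono' ?_ (.of_forall fun z => ?_)
  · have := hfc.measurable
    exact Measurable.aestronglyMeasurable (by fun_prop)
  · change |I z| ≤ B z + B z.swap
    by_cases h1 : z.1 ∈ K
    · exact (key z h1).trans (le_add_of_nonneg_right (hB0 _))
    by_cases h2 : z.2 ∈ K
    · rw [← hIs]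
      exact (key z.swap h2).trans (le_add_of_nonneg_left (hB0 _))
    · have : I z = 0 := by simp [hI, hfK _ h1, hfK _ h2]
      rw [this, abs_zero]
      exact add_nonneg (hB0 _) (hB0 _)

end Euclidean

section Weighted

variable {E : Type*} [NormedAddCommGroup E] {ψ : E → ℂ}

theorem hasCompactSupport_norm_sq_mul_norm_rpow (hψ : HasCompactSupport ψ) (c : ℝ) :
    HasCompactSupport fun x => ‖ψ x‖ ^ 2 * ‖x‖ ^ c :=
  hψ.mono fun x hx h => hx (by simp [h])

theorem norm_sq_mul_norm_rpow_mul_norm_rpow (h0 : (0 : E) ∉ tsupport ψ) (c e : ℝ) (x : E) :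
    ‖ψ x‖ ^ 2 * ‖x‖ ^ c * ‖x‖ ^ e = ‖ψ x‖ ^ 2 * ‖x‖ ^ (c + e) := by
  rcases eq_or_ne x 0 with rfl | hx
  · simp [image_eq_zero_of_notMem_tsupport h0]
  · rw [Real.rpow_add (norm_pos_iff.2 hx), mul_assoc]

theorem exists_pos_le_norm_of_mem_tsupport
    (h0 : (0 : E) ∉ tsupport ψ) : ∃ r > 0, ∀ x ∈ tsupport ψ, r ≤ ‖x‖ := by
  obtain ⟨r, hr, h⟩ := Metric.isOpen_iff.1 (isClosed_tsupport ψ).isOpen_compl 0 h0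
  refine ⟨r, hr, fun x hx => ?_⟩
  by_contra! hlt
  exact h (by simpa using hlt) hx

variable [InnerProductSpace ℝ E]

theorem contDiff_norm_sq_mul_norm_rpow (hψ : ContDiff ℝ (⊤ : ℕ∞) ψ)
    (h0 : (0 : E) ∉ tsupport ψ) (c : ℝ) : ContDiff ℝ 1 fun x => ‖ψ x‖ ^ 2 * ‖x‖ ^ c := by
  refine contDiff_iff_contDiffAt.2 fun x => ?_
  by_cases hx : x ∈ tsupport ψ
  · have hx0 : x ≠ 0 := fun h => h0 (h ▸ hx)
    have h1 : ContDiff ℝ 1 ψ := hψ.of_le (by exact_mod_cast le_top)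
    exact (h1.norm_sq ℝ).contDiffAt.mul
      ((contDiffAt_norm ℝ hx0).rpow_const_of_ne (norm_ne_zero_iff.2 hx0))
  · have h := notMem_tsupport_iff_eventuallyEq.1 hx
    refine (contDiffAt_const (c := (0 : ℝ))).congr_of_eventuallyEq ?_
    filter_upwards [h] with y hy
    simp [hy]

variable [FiniteDimensional ℝ E] [MeasurableSpace E] [BorelSpace E]

theorem integrable_norm_sq_mul_norm_rpow (hψ : ContDiff ℝ (⊤ : ℕ∞) ψ)
    (hs : HasCompactSupport ψ) (h0 : (0 : E) ∉ tsupport ψ) (c : ℝ) :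
    Integrable fun x => ‖ψ x‖ ^ 2 * ‖x‖ ^ c :=
  (contDiff_norm_sq_mul_norm_rpow hψ h0 c).continuous.integrable_of_hasCompactSupport
    (hasCompactSupport_norm_sq_mul_norm_rpow hs c)

/-- The integrand of the fractional form on the pair `(‖ψ‖² ‖x‖ ^ c, ‖x‖ ^ (-s))` is
integrable. -/
theorem integrable_fractionalForm [Nontrivial E] (hψ : ContDiff ℝ (⊤ : ℕ∞) ψ)
    (hs : HasCompactSupport ψ) (h0 : (0 : E) ∉ tsupport ψ) {a s : ℝ} (ha0 : 0 < a) (ha2 : a < 2)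
    (hs0 : 0 < s) (hsd : s < Module.finrank ℝ E) (c : ℝ) :
    Integrable fun z : E × E =>
      (‖ψ z.1‖ ^ 2 * ‖z.1‖ ^ c - ‖ψ z.2‖ ^ 2 * ‖z.2‖ ^ c) * (‖z.1‖ ^ (-s) - ‖z.2‖ ^ (-s)) /
        ‖z.1 - z.2‖ ^ ((Module.finrank ℝ E : ℝ) + a) := by
  have hd := contDiff_norm_sq_mul_norm_rpow hψ h0 c
  have hc := hasCompactSupport_norm_sq_mul_norm_rpow hs c
  obtain ⟨C, hC⟩ := hd.lipschitzWith_of_hasCompactSupport hc one_ne_zero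
  obtain ⟨M, hM⟩ := hd.continuous.bounded_above_of_compact_support hc
  obtain ⟨r, hr, hKr⟩ := exists_pos_le_norm_of_mem_tsupport h0
  refine integrable_sub_mul_sub_div_norm_rpow (f := fun x => ‖ψ x‖ ^ 2 * ‖x‖ ^ c) (L := C)
    ha0 ha2 hs0 hsd hr hd.continuous
    (fun x y => ?_) hM hs hKr fun x hx => ?_
  · simpa [Real.dist_eq, dist_eq_norm] using hC.dist_le_mul x y
  · simp [image_eq_zero_of_notMem_tsupport hx]

theorem Gamma_mul_integral_fractionalForm [Nontrivial E] (hψ : ContDiff ℝ (⊤ : ℕ∞) ψ)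
    (hs : HasCompactSupport ψ) (h0 : (0 : E) ∉ tsupport ψ) {a s : ℝ} (ha0 : 0 < a) (ha2 : a < 2)
    (hs0 : 0 < s) (hsd : s + a < Module.finrank ℝ E) (c : ℝ) :
    Gamma (s / 2) * (Gamma (((Module.finrank ℝ E : ℝ) + a) / 2) *
      ∫ z : E × E,
        (‖ψ z.1‖ ^ 2 * ‖z.1‖ ^ c - ‖ψ z.2‖ ^ 2 * ‖z.2‖ ^ c) * (‖z.1‖ ^ (-s) - ‖z.2‖ ^ (-s)) /
        ‖z.1 - z.2‖ ^ ((Module.finrank ℝ E : ℝ) + a)) =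
      2 * (π ^ ((Module.finrank ℝ E : ℝ) / 2) * Gamma ((s + a) / 2) *
        (Gamma (1 - a / 2) / (a / 2) * Gamma (((Module.finrank ℝ E : ℝ) - s) / 2) /
          Gamma (((Module.finrank ℝ E : ℝ) - s) / 2 - a / 2)) *
        ∫ x : E, ‖ψ x‖ ^ 2 * ‖x‖ ^ (c - (s + a))) := by
  have hi := integrable_norm_sq_mul_norm_rpow hψ hs h0
  have hm := norm_sq_mul_norm_rpow_mul_norm_rpow h0
  have h := integral_sub_mul_sub_div_norm_rpow ha0 ha2 hs0 hsd
    (contDiff_norm_sq_mul_norm_rpow hψ h0 c).continuous.measurable (hi c)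
    ((hi (c + -s)).congr (.of_forall fun x => (hm c (-s) x).symm))
    ((hi (c + -(s + a))).congr (.of_forall fun x => (hm c (-(s + a)) x).symm))
    (integrable_fractionalForm hψ hs h0 ha0 ha2 hs0 (by linarith) c)
  simp only [hm] at h
  rw [sub_eq_add_neg c]
  exact h

end Weighted

theorem abs_Gamma_neg_half {a : ℝ} (ha0 : 0 < a) (ha2 : a < 2) :
    |Gamma (-a / 2)| = Gamma (1 - a / 2) / (a / 2) := by
  have h := Real.Gamma_add_one (show -a / 2 ≠ 0 by linarith)
  have hp : 0 < Gamma (1 - a / 2) := Gamma_pos_of_pos (by linarith)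
  have e : -a / 2 + 1 = 1 - a / 2 := by ring
  rw [e] at h
  have h2 : Gamma (-a / 2) = -(Gamma (1 - a / 2) / (a / 2)) := by
    rw [h]; field_simp
  rw [h2, abs_neg, abs_of_pos (by positivity)]

/-- Evaluation of the sesquilinear form of the Jordan product on the pair
`(|ψ|²|x|^γ, |x|^{-γ})`. -/
theorem jordan_sesquilinear_eval
    (n : ℕ) (hn : 0 < n) (a b : ℝ) (ha : a ∈ Set.Ioo (0 : ℝ) 2) (hb : 0 < b)
    (hab : a + b < (n : ℝ)) (γ : ℝ) (hγ : γ = ((n : ℝ) + b - a) / 2)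
    (ψ : EuclideanSpace ℝ (Fin n) → ℂ)
    (hsmooth : ContDiff ℝ (⊤ : ℕ∞) ψ) (hsupp : HasCompactSupport ψ)
    (h0 : (0 : EuclideanSpace ℝ (Fin n)) ∉ tsupport ψ) :
    alphaConst n a / 2 *
        ∫ x : EuclideanSpace ℝ (Fin n), ∫ y : EuclideanSpace ℝ (Fin n),
          (2 * ‖ψ x‖ ^ 2 * ‖x‖ ^ b + 2 * ‖ψ y‖ ^ 2 * ‖y‖ ^ b -
              ‖ψ x‖ ^ 2 * ‖x‖ ^ γ * ‖y‖ ^ (b - γ) -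
              ‖ψ y‖ ^ 2 * ‖x‖ ^ (b - γ) * ‖y‖ ^ γ -
              ‖ψ x‖ ^ 2 * ‖x‖ ^ (b + γ) * ‖y‖ ^ (-γ) -
              ‖ψ y‖ ^ 2 * ‖x‖ ^ (-γ) * ‖y‖ ^ (b + γ)) /
            ‖x - y‖ ^ ((n : ℝ) + a) =
      (2 ^ a * Real.Gamma (((n : ℝ) - b + a) / 4) * Real.Gamma (((n : ℝ) + b + a) / 4) /
          (Real.Gamma (((n : ℝ) + b - a) / 4) * Real.Gamma (((n : ℝ) - b - a) / 4))) *
        ∫ x : EuclideanSpace ℝ (Fin n), ‖ψ x‖ ^ 2 * ‖x‖ ^ (b - a) := by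
  obtain ⟨ha0, ha2⟩ := ha
  have hd : Module.finrank ℝ (EuclideanSpace ℝ (Fin n)) = n := finrank_euclideanSpace_fin
  have : Nontrivial (EuclideanSpace ℝ (Fin n)) :=
    Module.nontrivial_of_finrank_pos (R := ℝ) (by rw [hd]; exact hn)
  have hγb : 0 < γ - b := by rw [hγ]; linarith
  have hγ0 : 0 < γ := by linarith
  have hγn : γ + a < n := by rw [hγ]; linarith
  have hi₁ := integrable_fractionalForm hsmooth hsupp h0 ha0 ha2 hγb
    (by rw [hd]; linarith) γ
  have hi₂ := integrable_fractionalForm hsmooth hsupp h0 ha0 ha2 hγ0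
    (by rw [hd]; linarith) (b + γ)
  have hv₁ := Gamma_mul_integral_fractionalForm hsmooth hsupp h0 ha0 ha2 hγb
    (by rw [hd]; linarith) γ
  have hv₂ := Gamma_mul_integral_fractionalForm hsmooth hsupp h0 ha0 ha2 hγ0
    (by rw [hd]; linarith) (b + γ)
  rw [hd] at hi₁ hi₂ hv₁ hv₂
  have hsum := integral_prod _ (hi₁.add hi₂)
  rw [← Measure.volume_eq_prod] at hsum
  simp only [Pi.add_apply] at hsum
  rw [integral_add hi₁ hi₂] at hsum
  have hm := norm_sq_mul_norm_rpow_mul_norm_rpow h0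
  have hpt : ∀ x y : EuclideanSpace ℝ (Fin n),
      (2 * ‖ψ x‖ ^ 2 * ‖x‖ ^ b + 2 * ‖ψ y‖ ^ 2 * ‖y‖ ^ b -
              ‖ψ x‖ ^ 2 * ‖x‖ ^ γ * ‖y‖ ^ (b - γ) -
              ‖ψ y‖ ^ 2 * ‖x‖ ^ (b - γ) * ‖y‖ ^ γ -
              ‖ψ x‖ ^ 2 * ‖x‖ ^ (b + γ) * ‖y‖ ^ (-γ) -
              ‖ψ y‖ ^ 2 * ‖x‖ ^ (-γ) * ‖y‖ ^ (b + γ)) / ‖x - y‖ ^ ((n : ℝ) + a) =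
      (‖ψ x‖ ^ 2 * ‖x‖ ^ γ - ‖ψ y‖ ^ 2 * ‖y‖ ^ γ) * (‖x‖ ^ (-(γ - b)) - ‖y‖ ^ (-(γ - b))) /
          ‖x - y‖ ^ ((n : ℝ) + a) +
        (‖ψ x‖ ^ 2 * ‖x‖ ^ (b + γ) - ‖ψ y‖ ^ 2 * ‖y‖ ^ (b + γ)) * (‖x‖ ^ (-γ) - ‖y‖ ^ (-γ)) /
          ‖x - y‖ ^ ((n : ℝ) + a) := fun x y => by
    have e1 : ∀ x, ‖ψ x‖ ^ 2 * ‖x‖ ^ γ * ‖x‖ ^ (b - γ) = ‖ψ x‖ ^ 2 * ‖x‖ ^ b := fun x => by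
      rw [hm]; congr 2; ring
    have e2 : ∀ x, ‖ψ x‖ ^ 2 * ‖x‖ ^ (b + γ) * ‖x‖ ^ (-γ) = ‖ψ x‖ ^ 2 * ‖x‖ ^ b := fun x => by
      rw [hm]; congr 2; ring
    rw [neg_sub, ← add_div]
    congr 1
    linear_combination -e1 x - e1 y - e2 x - e2 y
  simp only [hpt]
  rw [← hsum]
  have x1 : γ - (γ - b + a) = b - a := by ring
  have x2 : b + γ - (γ + a) = b - a := by ring
  have g1 : (γ - b) / 2 = ((n : ℝ) - b - a) / 4 := by rw [hγ]; ring
  have g2 : (γ - b + a) / 2 = ((n : ℝ) - b + a) / 4 := by rw [hγ]; ring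
  have g3 : ((n : ℝ) - (γ - b)) / 2 = ((n : ℝ) + b + a) / 4 := by rw [hγ]; ring
  have g4 : ((n : ℝ) + b + a) / 4 - a / 2 = ((n : ℝ) + b - a) / 4 := by ring
  have g5 : γ / 2 = ((n : ℝ) + b - a) / 4 := by rw [hγ]; ring
  have g6 : (γ + a) / 2 = ((n : ℝ) + b + a) / 4 := by rw [hγ]; ring
  have g7 : ((n : ℝ) - γ) / 2 = ((n : ℝ) - b + a) / 4 := by rw [hγ]; ring
  have g8 : ((n : ℝ) - b + a) / 4 - a / 2 = ((n : ℝ) - b - a) / 4 := by ring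
  rw [x1, g1, g2, g3, g4] at hv₁
  rw [x2, g5, g6, g7, g8] at hv₂
  have p1 : 0 < Gamma (((n : ℝ) - b - a) / 4) := Gamma_pos_of_pos (by linarith)
  have p2 : 0 < Gamma (((n : ℝ) + b - a) / 4) := Gamma_pos_of_pos (by linarith)
  have p3 : 0 < Gamma (((n : ℝ) + a) / 2) := Gamma_pos_of_pos (by linarith)
  have p4 : 0 < Gamma (1 - a / 2) / (a / 2) :=
    div_pos (Gamma_pos_of_pos (by linarith)) (by linarith)
  have hpi : π ^ (-(n : ℝ) / 2) * π ^ ((n : ℝ) / 2) = 1 := by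
    rw [← Real.rpow_add Real.pi_pos, show -(n : ℝ) / 2 + (n : ℝ) / 2 = 0 by ring, Real.rpow_zero]
  have h2 : (2 : ℝ) ^ (a - 1) * 2 = 2 ^ a := by
    rw [Real.rpow_sub_one two_ne_zero]; ring
  rw [alphaConst, abs_Gamma_neg_half ha0 ha2, ← h2]
  rw [mul_comm, ← eq_div_iff p1.ne', mul_comm, ← eq_div_iff p3.ne'] at hv₁
  rw [mul_comm, ← eq_div_iff p2.ne', mul_comm, ← eq_div_iff p3.ne'] at hv₂
  rw [hv₁, hv₂]
  generalize Gamma (1 - a / 2) / (a / 2) = G at *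
  generalize π ^ (-(n : ℝ) / 2) = P at *
  generalize π ^ ((n : ℝ) / 2) = Q at *
  set J := ∫ x : EuclideanSpace ℝ (Fin n), ‖ψ x‖ ^ 2 * ‖x‖ ^ (b - a)
  field_simp
  linear_combination 2 * Gamma (((n : ℝ) - b + a) / 4) * J * hpi
end
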